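/- arXiv:2402.12909 — 2 statements merged into one kernel-verified Lean document; each statement's English description precedes it below -/
import Mathlib

section
/- (Convergence dichotomy for sequences of Weierstrass m-triples) Let {(Σ, fₙ dz, gₙ)} be a sequence of Weierstrass m-triples on a fixed open Riemann surface Σ, with metrics ds²ₙ = (1+|gₙ|²)^m |fₙ|² |dz|² and Gaussian curvatures K_{ds²ₙ}. Suppose there is a nonconstant meromorphic function g on Σ such that gₙ converges to g locally uniformly on Σ with respect to the spherical distance, and that the sequence {K_{ds²ₙ}} is uniformly bounded on Σ. Then one of the following holds: (i) some subsequence of {K_{ds²ₙ}} converges to 0 locally uniformly on Σ; (ii) there is a subsequence of {ds²ₙ} and a holomorphic 1-form f dz on Σ such that ds² = (1+|g|²)^m |f|² |dz|² is a conformal metric on Σ (so that (Σ, f dz, g) is a Weierstrass m-triple) and the subsequence of metrics converges to ds² locally uniformly on Σ. -/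
open Filter Set MeasureTheory Topology
open scoped ENNReal

noncomputable section

/-- Half of the chordal (spherical) distance on the Riemann sphere `OnePoint ℂ`. -/
def sphDist : OnePoint ℂ → OnePoint ℂ → ℝ
  | OnePoint.infty, OnePoint.infty => 0
  | OnePoint.infty, (w : ℂ) => 1 / Real.sqrt (1 + ‖w‖ ^ 2)
  | (z : ℂ), OnePoint.infty => 1 / Real.sqrt (1 + ‖z‖ ^ 2)
  | (z : ℂ), (w : ℂ) => ‖z - w‖ / (Real.sqrt (1 + ‖z‖ ^ 2) * Real.sqrt (1 + ‖w‖ ^ 2))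

/-- A map `f : ℂ → Ĉ` is holomorphic on `U` if near each point of `U` it is, in the chart,
either a coerced holomorphic function or the reciprocal of a holomorphic function. -/
def SphHolomorphicOn (f : ℂ → OnePoint ℂ) (U : Set ℂ) : Prop :=
  ∀ z ∈ U, ∃ V : Set ℂ, IsOpen V ∧ z ∈ V ∧ ∃ h : ℂ → ℂ, DifferentiableOn ℂ h V ∧
    ((∀ w ∈ V, f w = (h w : OnePoint ℂ)) ∨
     (∀ w ∈ V, f w = if h w = 0 then OnePoint.infty else (((h w)⁻¹ : ℂ) : OnePoint ℂ)))

/-- Locally uniform convergence on `U` with respect to the spherical distance. -/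
def SphLocUnifOn (F : ℕ → ℂ → OnePoint ℂ) (f : ℂ → OnePoint ℂ) (U : Set ℂ) : Prop :=
  ∀ K : Set ℂ, K ⊆ U → IsCompact K → ∀ ε > (0:ℝ),
    ∀ᶠ n in Filter.atTop, ∀ z ∈ K, sphDist (F n z) (f z) < ε

/-- Locally uniform convergence of real-valued functions on `U`. -/
def RealLocUnifOn (F : ℕ → ℂ → ℝ) (f : ℂ → ℝ) (U : Set ℂ) : Prop :=
  ∀ K : Set ℂ, K ⊆ U → IsCompact K → ∀ ε > (0:ℝ),
    ∀ᶠ n in Filter.atTop, ∀ z ∈ K, |F n z - f z| < ε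

/-- A closed property for holomorphic maps into the Riemann sphere (on plane domains). -/
structure IsClosedProperty (P : Set ℂ → (ℂ → OnePoint ℂ) → Prop) : Prop where
  mem_holo : ∀ (U : Set ℂ) (f : ℂ → OnePoint ℂ), IsOpen U → IsConnected U →
    P U f → SphHolomorphicOn f U
  /-- (P1): stability under precomposition with unramified holomorphic maps. -/
  comp : ∀ (U V : Set ℂ) (φ : ℂ → ℂ) (f : ℂ → OnePoint ℂ),
    IsOpen U → IsConnected U → IsOpen V → IsConnected V →
    DifferentiableOn ℂ φ U → Set.MapsTo φ U V → (∀ z ∈ U, deriv φ z ≠ 0) →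
    P V f → P U (f ∘ φ)
  /-- (P2): if `f` has the property on every relatively compact subdomain, it has it globally. -/
  exhaust : ∀ (U : Set ℂ) (f : ℂ → OnePoint ℂ), IsOpen U → IsConnected U →
    SphHolomorphicOn f U →
    (∀ Ω : Set ℂ, IsOpen Ω → IsConnected Ω → IsCompact (closure Ω) → closure Ω ⊆ U → P Ω f) →
    P U f
  /-- (P3): `𝒫(U)` is closed under locally uniform spherical convergence in `𝑀(U)`. -/
  closed : ∀ (U : Set ℂ) (f : ℂ → OnePoint ℂ) (F : ℕ → ℂ → OnePoint ℂ),
    IsOpen U → IsConnected U → (∀ n, P U (F n)) → SphLocUnifOn F f U →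
    SphHolomorphicOn f U → P U f

/-- A compact property: a closed property all of whose families `𝒫(U)` are normal. -/
structure IsCompactProperty (P : Set ℂ → (ℂ → OnePoint ℂ) → Prop) extends
    IsClosedProperty P : Prop where
  /-- (P4): normality of `𝒫(U)` for every domain `U`. -/
  normal : ∀ (U : Set ℂ), IsOpen U → IsConnected U →
    ∀ F : ℕ → ℂ → OnePoint ℂ, (∀ n, P U (F n)) →
      ∃ φ : ℕ → ℕ, StrictMono φ ∧ ∃ g : ℂ → OnePoint ℂ, SphLocUnifOn (F ∘ φ) g U

/-- The spherical derivative of a map into the Riemann sphere (limit of spherical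
difference quotients). For `f` meromorphic near `z` this equals `|f'|/(1+|f|²)`. -/
def sphD (f : ℂ → OnePoint ℂ) (z : ℂ) : ℝ :=
  limUnder (𝓝[≠] z) (fun w => sphDist (f w) (f z) / ‖w - z‖)

/-- A Weierstrass `m`-triple on a plane domain `U`: a holomorphic `1`-form `f dz`, a
meromorphic function `g`, and the (continuous positive) conformal density `lam` of the
metric `ds² = (1+|g|²)^m |f|² |dz|²`. -/
structure WeierstrassTriple (m : ℕ) (U : Set ℂ) where
  isOpen : IsOpen U
  isConnected : IsConnected U
  f : ℂ → ℂ
  g : ℂ → OnePoint ℂ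
  f_holo : DifferentiableOn ℂ f U
  g_holo : SphHolomorphicOn g U
  g_mero : ∃ z ∈ U, g z ≠ OnePoint.infty
  lam : ℂ → ℝ
  lam_cont : ContinuousOn lam U
  lam_pos : ∀ z ∈ U, 0 < lam z
  lam_eq : ∀ z ∈ U, ∀ w : ℂ, g z = (w : OnePoint ℂ) →
    lam z = (1 + ‖w‖ ^ 2) ^ ((m : ℝ) / 2) * ‖f z‖

/-- The Gaussian curvature `K = -2m |g'|²/((1+|g|²)^{m+2}|f|²)` of a Weierstrass
`m`-triple, written via the spherical derivative: `K = -2m (g^#)² / λ²`. -/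
def WeierstrassTriple.curv {m : ℕ} {U : Set ℂ} (T : WeierstrassTriple m U) (z : ℂ) : ℝ :=
  -(2 * m) * (sphD T.g z) ^ 2 / (T.lam z) ^ 2

/-- A divergent `C¹` path in `U` starting at `p`, parametrized by `[0,1)`. -/
structure DivergentPath (U : Set ℂ) (p : ℂ) where
  toFun : ℝ → ℂ
  start : toFun 0 = p
  mem : ∀ t ∈ Set.Ico (0:ℝ) 1, toFun t ∈ U
  cont : ContinuousOn toFun (Set.Ico (0:ℝ) 1)
  diff : ∀ t ∈ Set.Ioo (0:ℝ) 1, DifferentiableAt ℝ toFun t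
  divergent : ∀ K : Set ℂ, IsCompact K → K ⊆ U →
    ∃ t₀ ∈ Set.Ico (0:ℝ) 1, ∀ t, t₀ ≤ t → t < 1 → toFun t ∉ K

/-- The length of a path with respect to the conformal metric with density `lam`. -/
def pathLen (lam : ℂ → ℝ) (γ : ℝ → ℂ) : ℝ≥0∞ :=
  ∫⁻ t in Set.Ioo (0:ℝ) 1, ENNReal.ofReal (lam (γ t) * ‖deriv γ t‖)

/-- The geodesic distance from `p` to the boundary of `U`: the infimum of lengths of
divergent paths starting at `p`. -/
def distToBdry (lam : ℂ → ℝ) (U : Set ℂ) (p : ℂ) : ℝ≥0∞ :=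
  ⨅ γ : DivergentPath U p, pathLen lam γ.toFun

/-- Completeness of the conformal metric with density `lam` on `U`: every divergent path
has infinite length. -/
def IsCompleteMetric (lam : ℂ → ℝ) (U : Set ℂ) : Prop :=
  ∀ p ∈ U, ∀ γ : DivergentPath U p, pathLen lam γ.toFun = ⊤

/-- The property `P_L`: `|f| < L` on `U`, or `f` is constant on `U`. -/
def PL (L : ℝ) (U : Set ℂ) (f : ℂ → OnePoint ℂ) : Prop :=
  SphHolomorphicOn f U ∧
    ((∀ z ∈ U, ∃ w : ℂ, f z = (w : OnePoint ℂ) ∧ ‖w‖ < L) ∨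
      (∀ z ∈ U, ∀ w ∈ U, f z = f w))

/-- The property `P_X`: `f` omits every value of `X`, or `f` is constant on `U`. -/
def PX (X : Set (OnePoint ℂ)) (U : Set ℂ) (f : ℂ → OnePoint ℂ) : Prop :=
  SphHolomorphicOn f U ∧ ((∀ z ∈ U, f z ∉ X) ∨ (∀ z ∈ U, ∀ w ∈ U, f z = f w))

/-- Second directional derivative of `u : ℂ → ℝ` at `z` in direction `v`. -/
def dirDeriv2 (u : ℂ → ℝ) (z v : ℂ) : ℝ :=
  deriv (deriv (fun t : ℝ => u (z + t • v))) 0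

/-- The Euclidean Laplacian of `u : ℂ → ℝ`. -/
def laplacian (u : ℂ → ℝ) (z : ℂ) : ℝ :=
  dirDeriv2 u z 1 + dirDeriv2 u z Complex.I


/-- A compact property `P` satisfies the `m`-curvature estimate if there is `C > 0` such
that `|K| d² ≤ C` for every Weierstrass `m`-triple whose meromorphic function satisfies `P`. -/
def SatisfiesCurvatureEstimate (P : Set ℂ → (ℂ → OnePoint ℂ) → Prop) (m : ℕ) : Prop :=
  ∃ C : ℝ, 0 < C ∧ ∀ (U : Set ℂ) (T : WeierstrassTriple m U), P U T.g →
    ∀ p ∈ U, ENNReal.ofReal |T.curv p| * (distToBdry T.lam U p) ^ 2 ≤ ENNReal.ofReal C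


/-- The inversion `z ↦ 1/z` of the Riemann sphere. -/
def sphInv : OnePoint ℂ → OnePoint ℂ
  | OnePoint.infty => ((0 : ℂ) : OnePoint ℂ)
  | (z : ℂ) => if z = 0 then OnePoint.infty else ((z⁻¹ : ℂ) : OnePoint ℂ)

theorem sphInv_infty : sphInv OnePoint.infty = ((0 : ℂ) : OnePoint ℂ) := rfl

theorem sphInv_coe (z : ℂ) :
    sphInv (z : OnePoint ℂ) = if z = 0 then OnePoint.infty else ((z⁻¹ : ℂ) : OnePoint ℂ) := rfl

theorem sphInv_sphInv (a : OnePoint ℂ) : sphInv (sphInv a) = a := by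
  induction a using OnePoint.rec with
  | infty => simp [sphInv_infty, sphInv_coe]
  | coe z =>
    by_cases hz : z = 0
    · simp [hz, sphInv_infty, sphInv_coe]
    · simp [hz, sphInv_coe]

theorem sphDist_coe_coe (z w : ℂ) : sphDist (z : OnePoint ℂ) (w : OnePoint ℂ) =
    ‖z - w‖ / (Real.sqrt (1 + ‖z‖ ^ 2) * Real.sqrt (1 + ‖w‖ ^ 2)) := rfl

theorem sphDist_infty_coe (w : ℂ) :
    sphDist OnePoint.infty (w : OnePoint ℂ) = 1 / Real.sqrt (1 + ‖w‖ ^ 2) := rfl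

theorem sphDist_coe_infty (z : ℂ) :
    sphDist (z : OnePoint ℂ) OnePoint.infty = 1 / Real.sqrt (1 + ‖z‖ ^ 2) := rfl

theorem sphDist_infty_infty : sphDist OnePoint.infty OnePoint.infty = 0 := rfl

theorem sqrt_one_add_norm_inv_sq {z : ℂ} (hz : z ≠ 0) :
    Real.sqrt (1 + ‖z⁻¹‖ ^ 2) = Real.sqrt (1 + ‖z‖ ^ 2) / ‖z‖ := by
  have h : 0 < ‖z‖ := norm_pos_iff.2 hz
  rw [norm_inv, show 1 + ‖z‖⁻¹ ^ 2 = (1 + ‖z‖ ^ 2) / ‖z‖ ^ 2 by field_simp; ring,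
    Real.sqrt_div (by positivity), Real.sqrt_sq h.le]

theorem sphDist_sphInv (a b : OnePoint ℂ) : sphDist (sphInv a) (sphInv b) = sphDist a b := by
  have key : ∀ z : ℂ, z ≠ 0 →
      1 / Real.sqrt (1 + ‖z‖ ^ 2) = ‖z⁻¹‖ / Real.sqrt (1 + ‖z⁻¹‖ ^ 2) := by
    intro z hz
    have h : 0 < ‖z‖ := norm_pos_iff.2 hz
    rw [sqrt_one_add_norm_inv_sq hz, norm_inv]
    field_simp
  induction a using OnePoint.rec with
  | infty =>
    induction b using OnePoint.rec with
    | infty => simp [sphInv_infty, sphDist_coe_coe, sphDist_infty_infty]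
    | coe w =>
      by_cases hw : w = 0
      · simp [hw, sphInv_infty, sphInv_coe, sphDist_coe_infty, sphDist_infty_coe]
      · simp only [hw, sphInv_infty, sphInv_coe, sphDist_coe_coe, sphDist_infty_coe, if_false,
          key w hw]
        simp
  | coe z =>
    induction b using OnePoint.rec with
    | infty =>
      by_cases hz : z = 0
      · simp [hz, sphInv_infty, sphInv_coe, sphDist_coe_infty, sphDist_infty_coe]
      · simp only [hz, sphInv_infty, sphInv_coe, sphDist_coe_coe, sphDist_coe_infty, if_false,
          key z hz]
        simp
    | coe w =>
      by_cases hz : z = 0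
      · by_cases hw : w = 0
        · simp [hz, hw, sphInv_coe, sphDist_infty_infty, sphDist_coe_coe]
        · have h : 0 < ‖w‖ := norm_pos_iff.2 hw
          simp only [hz, hw, sphInv_coe, sphDist_infty_coe, sphDist_coe_coe, if_false, if_true,
            sqrt_one_add_norm_inv_sq hw]
          simp
      · have h : 0 < ‖z‖ := norm_pos_iff.2 hz
        by_cases hw : w = 0
        · simp only [hz, hw, sphInv_coe, sphDist_coe_infty, sphDist_coe_coe, if_false, if_true,
            sqrt_one_add_norm_inv_sq hz]
          simp
        · have h' : 0 < ‖w‖ := norm_pos_iff.2 hw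
          simp only [hz, hw, sphInv_coe, sphDist_coe_coe, if_false,
            sqrt_one_add_norm_inv_sq hz, sqrt_one_add_norm_inv_sq hw]
          rw [inv_sub_inv hz hw, norm_div, norm_mul, norm_sub_rev w z]
          field_simp

theorem SphHolomorphicOn.sphInv_comp {g : ℂ → OnePoint ℂ} {U : Set ℂ}
    (hg : SphHolomorphicOn g U) : SphHolomorphicOn (fun z => sphInv (g z)) U := by
  intro z hz
  obtain ⟨V, hV, hzV, h, hh, H | H⟩ := hg z hz
  · refine ⟨V, hV, hzV, h, hh, Or.inr fun w hw => ?_⟩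
    simp only [H w hw, sphInv_coe]
  · refine ⟨V, hV, hzV, h, hh, Or.inl fun w hw => ?_⟩
    simp only [H w hw, ← sphInv_coe, sphInv_sphInv]

theorem sphD_sphInv_comp (g : ℂ → OnePoint ℂ) (z : ℂ) :
    sphD (fun w => sphInv (g w)) z = sphD g z := by
  simp only [sphD, sphDist_sphInv]

/-- The finite part of a point of the Riemann sphere, with value `0` at `∞`. -/
def sphFin (a : OnePoint ℂ) : ℂ := a.elim 0 id

theorem sphFin_coe (z : ℂ) : sphFin (z : OnePoint ℂ) = z := rfl

theorem coe_sphFin {a : OnePoint ℂ} (ha : a ≠ OnePoint.infty) :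
    ((sphFin a : ℂ) : OnePoint ℂ) = a := by
  induction a using OnePoint.rec with
  | infty => exact absurd rfl ha
  | coe z => rfl

theorem SphHolomorphicOn.differentiableOn_sphFin {g : ℂ → OnePoint ℂ} {U V : Set ℂ}
    (hg : SphHolomorphicOn g U) (hVU : V ⊆ U) (hfin : ∀ z ∈ V, g z ≠ OnePoint.infty)
    (hV : IsOpen V) : DifferentiableOn ℂ (fun z => sphFin (g z)) V := by
  intro z hz
  obtain ⟨W, hW, hzW, h, hh, H | H⟩ := hg z (hVU hz)
  · have : (fun w => sphFin (g w)) =ᶠ[𝓝 z] h := by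
      filter_upwards [hW.mem_nhds hzW] with w hw
      rw [H w hw, sphFin_coe]
    exact (this.differentiableAt_iff.2
      (hh.differentiableAt (hW.mem_nhds hzW))).differentiableWithinAt
  · have h0 : ∀ w ∈ W ∩ V, h w ≠ 0 := fun w hw h0 => hfin w hw.2 (by simp [H w hw.1, h0])
    have : (fun w => sphFin (g w)) =ᶠ[𝓝 z] fun w => (h w)⁻¹ := by
      filter_upwards [(hW.inter hV).mem_nhds ⟨hzW, hz⟩] with w hw
      rw [H w hw.1, if_neg (h0 w hw), sphFin_coe]
    exact (this.differentiableAt_iff.2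
      ((hh.differentiableAt (hW.mem_nhds hzW)).inv (h0 z ⟨hzW, hz⟩))).differentiableWithinAt

theorem sqrt_one_add_sq_le (a b : ℂ) :
    Real.sqrt (1 + ‖a‖ ^ 2) ≤ ‖a - b‖ + Real.sqrt (1 + ‖b‖ ^ 2) := by
  rw [Real.sqrt_le_left (by positivity)]
  have h1 : ‖a‖ ≤ ‖a - b‖ + ‖b‖ := by simpa using norm_add_le (a - b) b
  have h2 : ‖b‖ ≤ Real.sqrt (1 + ‖b‖ ^ 2) := Real.le_sqrt_of_sq_le (by linarith)
  have h3 := Real.sq_sqrt (show 0 ≤ 1 + ‖b‖ ^ 2 by positivity)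
  nlinarith [norm_nonneg a, norm_nonneg b, norm_nonneg (a - b)]

/-- Spherical closeness to a finite point controls the Euclidean distance. -/
theorem norm_sphFin_sub_le {a : OnePoint ℂ} {b : ℂ} {S ε : ℝ}
    (hb : Real.sqrt (1 + ‖b‖ ^ 2) ≤ S) (hε : ε * S ≤ 1 / 2) (h : sphDist a b < ε) :
    a ≠ OnePoint.infty ∧ ‖sphFin a - b‖ ≤ 2 * ε * S ^ 2 := by
  have hs : 0 < Real.sqrt (1 + ‖b‖ ^ 2) := Real.sqrt_pos.2 (by positivity)
  have hS : 0 < S := hs.trans_le hb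
  induction a using OnePoint.rec with
  | infty =>
    rw [sphDist_infty_coe, div_lt_iff₀ hs] at h
    have hε0 : 0 < ε := by
      by_contra hneg
      push Not at hneg
      nlinarith
    nlinarith
  | coe z =>
    refine ⟨OnePoint.coe_ne_infty z, ?_⟩
    rw [sphFin_coe]
    have hs' : 0 < Real.sqrt (1 + ‖z‖ ^ 2) := Real.sqrt_pos.2 (by positivity)
    rw [sphDist_coe_coe, div_lt_iff₀ (by positivity)] at h
    have h1 := sqrt_one_add_sq_le z b
    have hn := norm_nonneg (z - b)
    have hε0 : 0 < ε := by
      by_contra hneg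
      push Not at hneg
      have : 0 < Real.sqrt (1 + ‖z‖ ^ 2) * Real.sqrt (1 + ‖b‖ ^ 2) := by positivity
      nlinarith
    have h2 : ‖z - b‖ ≤ ε * ((‖z - b‖ + S) * S) := by
      refine h.le.trans ?_
      gcongr
      linarith
    nlinarith

theorem sphD_eq {g : ℂ → OnePoint ℂ} {h : ℂ → ℂ} {z : ℂ}
    (hgh : ∀ᶠ w in 𝓝 z, g w = (h w : OnePoint ℂ)) (hd : DifferentiableAt ℂ h z) :
    sphD g z = ‖deriv h z‖ / (1 + ‖h z‖ ^ 2) := by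
  refine Tendsto.limUnder_eq ?_
  have h1 : Tendsto (fun w => ‖slope h z w‖ /
      (Real.sqrt (1 + ‖h w‖ ^ 2) * Real.sqrt (1 + ‖h z‖ ^ 2))) (𝓝[≠] z)
      (𝓝 (‖deriv h z‖ / (Real.sqrt (1 + ‖h z‖ ^ 2) * Real.sqrt (1 + ‖h z‖ ^ 2)))) := by
    have hc : Tendsto h (𝓝[≠] z) (𝓝 (h z)) := hd.continuousAt.tendsto.mono_left nhdsWithin_le_nhds
    refine (hasDerivAt_iff_tendsto_slope.1 hd.hasDerivAt).norm.div
      ((((hc.norm.pow 2).const_add 1).sqrt).mul_const _) ?_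
    have : 0 < Real.sqrt (1 + ‖h z‖ ^ 2) := Real.sqrt_pos.2 (by positivity)
    positivity
  rw [Real.mul_self_sqrt (by positivity)] at h1
  refine h1.congr' ?_
  filter_upwards [nhdsWithin_le_nhds hgh] with w hw
  rw [hw, hgh.self_of_nhds, sphDist_coe_coe, slope_def_field, norm_div]
  field_simp

theorem SphHolomorphicOn.exists_chart {g : ℂ → OnePoint ℂ} {U : Set ℂ} {z : ℂ}
    (hg : SphHolomorphicOn g U) (hz : z ∈ U) :
    ∃ σ : OnePoint ℂ → OnePoint ℂ, (σ = id ∨ σ = sphInv) ∧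
      ∃ R > 0, ∃ h : ℂ → ℂ, DifferentiableOn ℂ h (Metric.ball z R) ∧
        ∀ w ∈ Metric.ball z R, σ (g w) = (h w : OnePoint ℂ) := by
  obtain ⟨V, hV, hzV, h, hh, H | H⟩ := hg z hz
  · obtain ⟨R, hR, hRV⟩ := Metric.isOpen_iff.1 hV z hzV
    exact ⟨id, Or.inl rfl, R, hR, h, hh.mono hRV, fun w hw => H w (hRV hw)⟩
  · obtain ⟨R, hR, hRV⟩ := Metric.isOpen_iff.1 hV z hzV
    refine ⟨sphInv, Or.inr rfl, R, hR, h, hh.mono hRV, fun w hw => ?_⟩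
    simp only [H w (hRV hw), ← sphInv_coe, sphInv_sphInv]

theorem chart_injective {σ : OnePoint ℂ → OnePoint ℂ} (hσ : σ = id ∨ σ = sphInv) :
    Function.Injective σ := by
  rcases hσ with rfl | rfl
  · exact Function.injective_id
  · exact Function.Involutive.injective sphInv_sphInv

/-- Identity theorem: a meromorphic function on a domain which is constant near one point is
constant. -/
theorem SphHolomorphicOn.eq_of_eventually_eq {g : ℂ → OnePoint ℂ} {U : Set ℂ}
    (hg : SphHolomorphicOn g U) (hU : IsPreconnected U) {a : ℂ} (ha : a ∈ U)
    {c : OnePoint ℂ} (hc : ∀ᶠ w in 𝓝 a, g w = c) {b : ℂ} (hb : b ∈ U) : g b = c := by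
  have key := hU.induction₂'
    (fun x y => (∀ᶠ w in 𝓝 x, g w = c) → ∀ᶠ w in 𝓝 y, g w = c) (fun x hx => ?_)
    (fun x y z _ _ _ h1 h2 h => h2 (h1 h)) ha hb
  · exact (key hc).self_of_nhds
  obtain ⟨σ, hσ, R, hR, h, hd, hgh⟩ := hg.exists_chart hx
  have hana : AnalyticOnNhd ℂ h (Metric.ball x R) := hd.analyticOnNhd Metric.isOpen_ball
  have spread : ∀ p ∈ Metric.ball x R, (∀ᶠ w in 𝓝 p, g w = c) →
      ∀ q ∈ Metric.ball x R, ∀ᶠ w in 𝓝 q, g w = c := by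
    intro p hp hpc q hq
    have hcp : σ c = h p := by rw [← hpc.self_of_nhds, hgh p hp]
    have h1 : h =ᶠ[𝓝 p] fun _ => h p := by
      filter_upwards [hpc, Metric.isOpen_ball.mem_nhds hp] with w hw hwB
      have := hgh w hwB
      rw [hw, hcp] at this
      exact (OnePoint.coe_injective this).symm
    have h2 := hana.eqOn_of_preconnected_of_eventuallyEq analyticOnNhd_const
      (convex_ball x R).isPreconnected hp h1
    filter_upwards [Metric.isOpen_ball.mem_nhds hq] with w hw
    apply chart_injective hσ
    rw [hgh w hw, hcp, h2 hw]
  filter_upwards [nhdsWithin_le_nhds (Metric.ball_mem_nhds x hR)] with y hy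
  exact ⟨fun h => spread x (Metric.mem_ball_self hR) h y hy,
    fun h => spread y hy h x (Metric.mem_ball_self hR)⟩

/-- Near poles of `g`, the form `f dz` of a Weierstrass triple is `F h ^ m dz` with `h = 1 / g`
and `F` holomorphic. -/
theorem WeierstrassTriple.exists_factor {m : ℕ} {U V : Set ℂ} (T : WeierstrassTriple m U)
    (hV : IsOpen V) (hVU : V ⊆ U) {H : ℂ → ℂ} (hH : DifferentiableOn ℂ H V)
    (hgH : ∀ w ∈ V, sphInv (T.g w) = (H w : OnePoint ℂ)) :
    ∃ F : ℂ → ℂ, DifferentiableOn ℂ F V ∧ (∀ w ∈ V, T.f w = F w * H w ^ m) ∧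
      ∀ w ∈ V, T.lam w = (1 + ‖H w‖ ^ 2) ^ ((m : ℝ) / 2) * ‖F w‖ := by
  have hana : AnalyticOnNhd ℂ H V := hH.analyticOnNhd hV
  have hne : ∀ w ∈ V, ∀ᶠ v in 𝓝[≠] w, H v ≠ 0 := by
    intro w hw
    refine (hana w hw).eventually_eq_zero_or_eventually_ne_zero.resolve_left fun h0 => ?_
    obtain ⟨z, hz, hgz⟩ := T.g_mero
    refine hgz (T.g_holo.eq_of_eventually_eq T.isConnected.isPreconnected (hVU hw) ?_ hz)
    filter_upwards [h0, hV.mem_nhds hw] with v hv hvV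
    rw [← sphInv_sphInv (T.g v), hgH v hvV, hv, sphInv_coe, if_pos rfl]
  set q : ℂ → ℂ := fun w => T.f w / H w ^ m with hq
  have hlam : ∀ w ∈ V, H w ≠ 0 → T.lam w = (1 + ‖H w‖ ^ 2) ^ ((m : ℝ) / 2) * ‖q w‖ := by
    intro w hw h0
    have hn : 0 < ‖H w‖ := norm_pos_iff.2 h0
    have hgw : T.g w = ((H w)⁻¹ : ℂ) := by
      rw [← sphInv_sphInv (T.g w), hgH w hw, sphInv_coe, if_neg h0]
    rw [T.lam_eq w (hVU hw) _ hgw, hq, norm_div, norm_pow, norm_inv,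
      show 1 + ‖H w‖⁻¹ ^ 2 = (1 + ‖H w‖ ^ 2) / ‖H w‖ ^ 2 by field_simp; ring,
      Real.div_rpow (by positivity) (by positivity), ← Real.rpow_natCast ‖H w‖ 2,
      ← Real.rpow_mul hn.le, ← Real.rpow_natCast ‖H w‖ m]
    push_cast
    rw [show (2 : ℝ) * ((m : ℝ) / 2) = m by ring]
    field_simp
  have hqle : ∀ w ∈ V, H w ≠ 0 → ‖q w‖ ≤ T.lam w := by
    intro w hw h0
    rw [hlam w hw h0]
    exact le_mul_of_one_le_left (norm_nonneg _)
      (Real.one_le_rpow (by nlinarith [sq_nonneg ‖H w‖]) (by positivity))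
  have hqd : ∀ w ∈ V, H w ≠ 0 → DifferentiableAt ℂ q w := fun w hw h0 =>
    (T.f_holo.differentiableAt (T.isOpen.mem_nhds (hVU hw))).div
      ((hH.differentiableAt (hV.mem_nhds hw)).pow m) (pow_ne_zero m h0)
  set F : ℂ → ℂ := fun w => limUnder (𝓝[≠] w) q with hF
  have hFq : ∀ w ∈ V, H w ≠ 0 → F w = q w := fun w hw h0 =>
    ((hqd w hw h0).continuousAt.tendsto.mono_left nhdsWithin_le_nhds).limUnder_eq
  have hFd : DifferentiableOn ℂ F V := by
    intro w hw
    have h1 : ∀ᶠ v in 𝓝 w, v ≠ w → H v ≠ 0 := eventually_nhdsWithin_iff.1 (hne w hw)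
    have h2 : ∀ᶠ v in 𝓝 w, T.lam v < T.lam w + 1 :=
      ((T.lam_cont.continuousAt (T.isOpen.mem_nhds (hVU hw))).eventually_lt_const (by linarith))
    obtain ⟨s, hs, hso, hws⟩ := eventually_nhds_iff.1 ((h1.and h2).and (hV.mem_nhds hw))
    have h3 := Complex.differentiableOn_update_limUnder_of_bddAbove (f := q) (hso.mem_nhds hws)
      (fun v hv => (hqd v (hs v hv.1).2 ((hs v hv.1).1.1 hv.2)).differentiableWithinAt)
      ⟨T.lam w + 1, by
        rintro _ ⟨v, hv, rfl⟩
        exact (hqle v (hs v hv.1).2 ((hs v hv.1).1.1 hv.2)).trans (hs v hv.1).1.2.le⟩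
    have h4 : F =ᶠ[𝓝 w] Function.update q w (limUnder (𝓝[≠] w) q) := by
      filter_upwards [hso.mem_nhds hws] with v hv
      by_cases hvw : v = w
      · subst hvw; simp [hF]
      · rw [Function.update_of_ne hvw, hFq v (hs v hv).2 ((hs v hv).1.1 hvw)]
    exact (h4.differentiableAt_iff.2
      (h3.differentiableAt (hso.mem_nhds hws))).differentiableWithinAt
  refine ⟨F, hFd, fun w hw => ?_, fun w hw => ?_⟩
  · have hc1 : Tendsto T.f (𝓝[≠] w) (𝓝 (T.f w)) :=
      ((T.f_holo.differentiableAt (T.isOpen.mem_nhds (hVU hw))).continuousAt.tendsto).mono_left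
        nhdsWithin_le_nhds
    have hc2 : Tendsto (fun v => F v * H v ^ m) (𝓝[≠] w) (𝓝 (F w * H w ^ m)) :=
      (((hFd.differentiableAt (hV.mem_nhds hw)).mul
        ((hH.differentiableAt (hV.mem_nhds hw)).pow m)).continuousAt.tendsto).mono_left
        nhdsWithin_le_nhds
    refine tendsto_nhds_unique hc1 (hc2.congr' ?_)
    filter_upwards [hne w hw, nhdsWithin_le_nhds (hV.mem_nhds hw)] with v hv hvV
    rw [hFq v hvV hv, hq]
    field_simp
  · have hc1 : Tendsto T.lam (𝓝[≠] w) (𝓝 (T.lam w)) :=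
      (T.lam_cont.continuousAt (T.isOpen.mem_nhds (hVU hw))).tendsto.mono_left nhdsWithin_le_nhds
    have hHc : Tendsto H (𝓝[≠] w) (𝓝 (H w)) :=
      (hH.differentiableAt (hV.mem_nhds hw)).continuousAt.tendsto.mono_left nhdsWithin_le_nhds
    have hFc : Tendsto F (𝓝[≠] w) (𝓝 (F w)) :=
      (hFd.differentiableAt (hV.mem_nhds hw)).continuousAt.tendsto.mono_left nhdsWithin_le_nhds
    have hc2 := (((hHc.norm.pow 2).const_add 1).rpow_const (p := (m : ℝ) / 2)
      (Or.inr (by positivity))).mul hFc.norm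
    refine tendsto_nhds_unique hc1 (hc2.congr' ?_)
    filter_upwards [hne w hw, nhdsWithin_le_nhds (hV.mem_nhds hw)] with v hv hvV
    rw [hlam v hvV hv, hFq v hvV hv]

theorem tendsto_prod_of_forall_eventually_dist_lt {E : Type*} [PseudoMetricSpace E]
    {H : ℕ → ℂ → E} {h : ℂ → E} {V : Set ℂ} {z : ℂ} (hV : V ∈ 𝓝 z) (hh : ContinuousAt h z)
    (hu : ∀ ε > (0 : ℝ), ∀ᶠ n in atTop, ∀ w ∈ V, dist (H n w) (h w) < ε) :
    Tendsto (fun p : ℕ × ℂ => H p.1 p.2) (atTop ×ˢ 𝓝 z) (𝓝 (h z)) := by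
  rw [Metric.tendsto_nhds]
  intro ε hε
  have h1 : ∀ᶠ w in 𝓝 z, w ∈ V ∧ dist (h w) (h z) < ε / 2 :=
    (show ∀ᶠ w in 𝓝 z, w ∈ V from hV).and (Metric.tendsto_nhds.1 hh.tendsto (ε / 2) (half_pos hε))
  filter_upwards [(hu (ε / 2) (half_pos hε)).prod_mk h1] with p hp
  have := dist_triangle (H p.1 p.2) (h p.2) (h z)
  linarith [hp.1 p.2 hp.2.1, hp.2.2]

theorem IsCompact.eventually_forall_of_prod {K : Set ℂ} (hK : IsCompact K) {P : ℕ → ℂ → Prop}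
    (h : ∀ z ∈ K, ∀ᶠ p : ℕ × ℂ in atTop ×ˢ 𝓝 z, P p.1 p.2) :
    ∀ᶠ n in atTop, ∀ z ∈ K, P n z := by
  have h1 : {p : ℕ × ℂ | P p.1 p.2} ∈ atTop ×ˢ 𝓝ˢ K :=
    hK.mem_prod_nhdsSet_of_forall fun z hz => h z hz
  obtain ⟨s, hs, t, ht, hst⟩ := Filter.mem_prod_iff.1 h1
  filter_upwards [hs] with n hn z hz
  exact hst (Set.mk_mem_prod hn (subset_of_mem_nhdsSet ht hz))

/-- Local holomorphic data for a sequence of Weierstrass triples whose meromorphic functions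
converge: in a chart of the sphere `gₙ` becomes `H n`, converging to `h`, and
`fₙ = F n * H n ^ k`. -/
structure LocalChart {m : ℕ} {U : Set ℂ} (T : ℕ → WeierstrassTriple m U) (z₀ : ℂ) where
  R : ℝ
  R_pos : 0 < R
  ball_subset : Metric.ball z₀ R ⊆ U
  h : ℂ → ℂ
  H : ℕ → ℂ → ℂ
  F : ℕ → ℂ → ℂ
  N : ℕ
  k : ℕ
  h_diff : DifferentiableOn ℂ h (Metric.ball z₀ R)
  h_nonconst : ∀ c, ¬ ∀ᶠ w in 𝓝 z₀, h w = c
  H_diff : ∀ n ≥ N, DifferentiableOn ℂ (H n) (Metric.ball z₀ R)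
  F_diff : ∀ n ≥ N, DifferentiableOn ℂ (F n) (Metric.ball z₀ R)
  lam_eq : ∀ n ≥ N, ∀ w ∈ Metric.ball z₀ R,
    (T n).lam w = (1 + ‖H n w‖ ^ 2) ^ ((m : ℝ) / 2) * ‖F n w‖
  f_eq : ∀ n ≥ N, ∀ w ∈ Metric.ball z₀ R, (T n).f w = F n w * H n w ^ k
  f_le : ∀ n ≥ N, ∀ w ∈ Metric.ball z₀ R, ‖(T n).f w‖ ≤ (T n).lam w
  sphD_eq : ∀ n ≥ N, ∀ w ∈ Metric.ball z₀ R,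
    sphD (T n).g w = ‖deriv (H n) w‖ / (1 + ‖H n w‖ ^ 2)
  tendsto : ∀ z ∈ Metric.ball z₀ R,
    Tendsto (fun p : ℕ × ℂ => H p.1 p.2) (atTop ×ˢ 𝓝 z) (𝓝 (h z))

theorem nonempty_localChart {m : ℕ} {U : Set ℂ} (T : ℕ → WeierstrassTriple m U)
    {g : ℂ → OnePoint ℂ} (hg : SphHolomorphicOn g U) (hnc : ∃ z ∈ U, ∃ w ∈ U, g z ≠ g w)
    (hconv : SphLocUnifOn (fun n => (T n).g) g U) {z₀ : ℂ} (hz₀ : z₀ ∈ U) :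
    Nonempty (LocalChart T z₀) := by
  have hUo : IsOpen U := (T 0).isOpen
  have hUc : IsPreconnected U := (T 0).isConnected.isPreconnected
  obtain ⟨σ, hσ, R₀, hR₀, h, hd, hgh⟩ := hg.exists_chart hz₀
  have hhc : ContinuousAt h z₀ :=
    (hd.differentiableAt (Metric.ball_mem_nhds z₀ hR₀)).continuousAt
  have hev : ∀ᶠ w in 𝓝 z₀, (w ∈ Metric.ball z₀ R₀ ∧ w ∈ U) ∧ ‖h w‖ < ‖h z₀‖ + 1 := by
    filter_upwards [Metric.ball_mem_nhds z₀ hR₀, hUo.mem_nhds hz₀,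
      hhc.norm.eventually_lt_const (show ‖h z₀‖ < ‖h z₀‖ + 1 by linarith)] with w h1 h2 h3
    exact ⟨⟨h1, h2⟩, h3⟩
  obtain ⟨R, hR, hRsub⟩ := Metric.nhds_basis_closedBall.mem_iff.1 hev
  have hbc : Metric.ball z₀ R ⊆ Metric.closedBall z₀ R := Metric.ball_subset_closedBall
  have hbU : Metric.ball z₀ R ⊆ U := fun w hw => (hRsub (hbc hw)).1.2
  have hbR : Metric.ball z₀ R ⊆ Metric.ball z₀ R₀ := fun w hw => (hRsub (hbc hw)).1.1
  have hcU : Metric.closedBall z₀ R ⊆ U := fun w hw => (hRsub hw).1.2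
  set M := ‖h z₀‖ + 1 with hM
  set S := Real.sqrt (1 + M ^ 2) with hS
  have hS0 : 0 < S := Real.sqrt_pos.2 (by positivity)
  have hhS : ∀ w ∈ Metric.ball z₀ R, Real.sqrt (1 + ‖h w‖ ^ 2) ≤ S := by
    intro w hw
    have := (hRsub (hbc hw)).2.le
    exact Real.sqrt_le_sqrt (by gcongr)
  have hσd : ∀ a b, sphDist (σ a) (σ b) = sphDist a b := by
    rcases hσ with rfl | rfl
    · exact fun a b => rfl
    · exact sphDist_sphInv
  have hclose : ∀ ε > 0, ε * S ≤ 1 / 2 → ∀ᶠ n in atTop, ∀ w ∈ Metric.ball z₀ R,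
      σ ((T n).g w) ≠ OnePoint.infty ∧ ‖sphFin (σ ((T n).g w)) - h w‖ ≤ 2 * ε * S ^ 2 := by
    intro ε hε hεS
    filter_upwards [hconv _ hcU (isCompact_closedBall z₀ R) ε hε] with n hn w hw
    refine norm_sphFin_sub_le (hhS w hw) hεS ?_
    rw [← hgh w (hbR hw), hσd]
    exact hn w (hbc hw)
  obtain ⟨N, hN⟩ := eventually_atTop.1 (hclose (1 / (2 * S)) (by positivity)
    (by field_simp; rfl))
  have hfin : ∀ n ≥ N, ∀ w ∈ Metric.ball z₀ R, σ ((T n).g w) ≠ OnePoint.infty :=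
    fun n hn w hw => (hN n hn w hw).1
  set H : ℕ → ℂ → ℂ := fun n w => sphFin (σ ((T n).g w)) with hH
  have hgH : ∀ n ≥ N, ∀ w ∈ Metric.ball z₀ R, σ ((T n).g w) = (H n w : OnePoint ℂ) :=
    fun n hn w hw => (coe_sphFin (hfin n hn w hw)).symm
  have hσg : ∀ n, SphHolomorphicOn (fun w => σ ((T n).g w)) U := by
    rcases hσ with rfl | rfl
    · exact fun n => (T n).g_holo
    · exact fun n => (T n).g_holo.sphInv_comp
  have hHd : ∀ n ≥ N, DifferentiableOn ℂ (H n) (Metric.ball z₀ R) := fun n hn =>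
    (hσg n).differentiableOn_sphFin hbU (hfin n hn) Metric.isOpen_ball
  have hfac : ∃ k : ℕ, (k = 0 ∨ k = m) ∧ ∀ n ≥ N, ∃ F : ℂ → ℂ,
      DifferentiableOn ℂ F (Metric.ball z₀ R) ∧
      (∀ w ∈ Metric.ball z₀ R, (T n).f w = F w * H n w ^ k) ∧
      ∀ w ∈ Metric.ball z₀ R, (T n).lam w = (1 + ‖H n w‖ ^ 2) ^ ((m : ℝ) / 2) * ‖F w‖ := by
    rcases hσ with rfl | rfl
    · refine ⟨0, Or.inl rfl, fun n hn => ⟨(T n).f, (T n).f_holo.mono hbU, by simp,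
        fun w hw => (T n).lam_eq w (hbU hw) _ (hgH n hn w hw)⟩⟩
    · exact ⟨m, Or.inr rfl, fun n hn =>
        (T n).exists_factor Metric.isOpen_ball hbU (hHd n hn) (hgH n hn)⟩
  obtain ⟨k, hk, hF⟩ := hfac
  choose! F hFd hFf hFl using hF
  refine ⟨⟨R, hR, hbU, h, H, F, N, k, hd.mono hbR, ?_, hHd, hFd, hFl, hFf, ?_, ?_, ?_⟩⟩
  · intro c hc
    obtain ⟨z, hz, w, hw, hzw⟩ := hnc
    have hgc : ∀ᶠ v in 𝓝 z₀, g v = g z₀ := by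
      filter_upwards [hc, Metric.ball_mem_nhds z₀ hR₀] with v hv hvB
      apply chart_injective hσ
      rw [hgh v hvB, hgh z₀ (Metric.mem_ball_self hR₀), hv, hc.self_of_nhds]
    exact hzw ((hg.eq_of_eventually_eq hUc hz₀ hgc hz).trans
      (hg.eq_of_eventually_eq hUc hz₀ hgc hw).symm)
  · intro n hn w hw
    rw [hFf n hn w hw, hFl n hn w hw, norm_mul, norm_pow, mul_comm]
    gcongr
    rcases hk with rfl | rfl
    · rw [pow_zero]
      exact Real.one_le_rpow (by nlinarith [sq_nonneg ‖H n w‖]) (by positivity)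
    · calc ‖H n w‖ ^ k = (‖H n w‖ ^ 2) ^ ((k : ℝ) / 2) := by
            rw [← Real.rpow_natCast ‖H n w‖ 2, ← Real.rpow_mul (norm_nonneg _),
              ← Real.rpow_natCast]
            push_cast
            congr 1
            ring
        _ ≤ _ := Real.rpow_le_rpow (by positivity) (by linarith) (by positivity)
  · intro n hn w hw
    have h1 : sphD (T n).g w = sphD (fun v => σ ((T n).g v)) w := by
      rcases hσ with rfl | rfl
      · rfl
      · exact (sphD_sphInv_comp _ _).symm
    rw [h1]
    refine sphD_eq ?_ ((hHd n hn).differentiableAt (Metric.isOpen_ball.mem_nhds hw))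
    filter_upwards [Metric.isOpen_ball.mem_nhds hw] with v hv using hgH n hn v hv
  · intro z hz
    refine tendsto_prod_of_forall_eventually_dist_lt (Metric.isOpen_ball.mem_nhds hz)
      (hd.differentiableAt (Metric.isOpen_ball.mem_nhds (hbR hz))).continuousAt fun ε hε => ?_
    have h1 : 0 < min (1 / (2 * S)) (ε / (4 * S ^ 2)) := by positivity
    have h2 : min (1 / (2 * S)) (ε / (4 * S ^ 2)) * S ≤ 1 / 2 := by
      calc min (1 / (2 * S)) (ε / (4 * S ^ 2)) * S ≤ 1 / (2 * S) * S := by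
            gcongr
            exact min_le_left _ _
        _ = 1 / 2 := by field_simp
    filter_upwards [hclose _ h1 h2] with n hn w hw
    rw [dist_eq_norm]
    refine (hn w hw).2.trans_lt ?_
    calc 2 * min (1 / (2 * S)) (ε / (4 * S ^ 2)) * S ^ 2 ≤ 2 * (ε / (4 * S ^ 2)) * S ^ 2 := by
          gcongr
          exact min_le_right _ _
      _ = ε / 2 := by field_simp; norm_num
      _ < ε := half_lt_self hε

theorem IsOpen.tendstoLocallyUniformlyOn_iff_tendsto_prod {E : Type*} [PseudoMetricSpace E]
    {H : ℕ → ℂ → E} {h : ℂ → E} {V : Set ℂ} (hV : IsOpen V) (hh : ContinuousOn h V) :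
    TendstoLocallyUniformlyOn H h atTop V ↔
      ∀ z ∈ V, Tendsto (fun p : ℕ × ℂ => H p.1 p.2) (atTop ×ˢ 𝓝 z) (𝓝 (h z)) := by
  rw [hV.tendstoLocallyUniformlyOn_iff_forall_tendsto]
  refine forall₂_congr fun z hz => ?_
  have hhz : Tendsto (fun p : ℕ × ℂ => h p.2) (atTop ×ˢ 𝓝 z) (𝓝 (h z)) :=
    (hh.continuousAt (hV.mem_nhds hz)).tendsto.comp tendsto_snd
  refine ⟨fun H1 => hhz.congr_uniformity H1, fun H1 => ?_⟩
  exact (hhz.prodMk_nhds H1).mono_right (nhds_le_uniformity _)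

theorem exists_norm_eq_mul_exp_of_ne_zero {F : ℂ → ℂ} {z₀ : ℂ} {R : ℝ} (hR : 0 < R)
    (hF : DifferentiableOn ℂ F (Metric.ball z₀ R)) (h0 : ∀ w ∈ Metric.ball z₀ R, F w ≠ 0) :
    ∃ G : ℂ → ℂ, DifferentiableOn ℂ G (Metric.ball z₀ R) ∧ G z₀ = 0 ∧
      ∀ w ∈ Metric.ball z₀ R, F w = F z₀ * Complex.exp (G w) := by
  have hd : DifferentiableOn ℂ (logDeriv F) (Metric.ball z₀ R) :=
    (hF.deriv Metric.isOpen_ball).div hF h0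
  obtain ⟨G, hG⟩ := hd.isExactOn_ball
  have hGd : DifferentiableOn ℂ G (Metric.ball z₀ R) := fun w hw =>
    (hG w hw).differentiableAt.differentiableWithinAt
  have hz₀ := Metric.mem_ball_self (x := z₀) hR
  have hE : DifferentiableOn ℂ (fun w => Complex.exp (G w)) (Metric.ball z₀ R) := hGd.cexp
  have hlog : EqOn (logDeriv F) (logDeriv fun w => Complex.exp (G w)) (Metric.ball z₀ R) := by
    intro w hw
    rw [logDeriv_apply (fun w => Complex.exp (G w)), ((hG w hw).cexp).deriv]
    field_simp [Complex.exp_ne_zero]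
  obtain ⟨c, hc, hFc⟩ := (logDeriv_eqOn_iff hF hE Metric.isOpen_ball
    (convex_ball z₀ R).isPreconnected (fun w _ => Complex.exp_ne_zero _) h0).1 hlog
  refine ⟨fun w => G w - G z₀, hGd.sub_const _, sub_self _, fun w hw => ?_⟩
  rw [hFc hw, hFc hz₀, Complex.exp_sub]
  simp only [Pi.smul_apply, smul_eq_mul]
  field_simp [Complex.exp_ne_zero]

theorem norm_le_pow_three_div_of_lt_norm {F : ℂ → ℂ} {z₀ z : ℂ} {R c : ℝ} (hR : 0 < R)
    (hc : 0 < c) (hF : DifferentiableOn ℂ F (Metric.ball z₀ R))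
    (hcF : ∀ w ∈ Metric.ball z₀ R, c < ‖F w‖) (hz : dist z z₀ ≤ R / 2) :
    ‖F z‖ ≤ ‖F z₀‖ ^ 3 / c ^ 2 := by
  obtain ⟨G, hGd, hG0, hFG⟩ := exists_norm_eq_mul_exp_of_ne_zero hR hF fun w hw h => by
    have := hcF w hw
    rw [h, norm_zero] at this
    linarith
  have hz₀ := hcF z₀ (Metric.mem_ball_self hR)
  have hF₀ : 0 < ‖F z₀‖ := hc.trans hz₀
  have hadd : ∀ ζ ∈ Metric.ball (0 : ℂ) R, z₀ + ζ ∈ Metric.ball z₀ R := by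
    intro ζ hζ
    simpa [dist_eq_norm] using hζ
  have hnorm : ∀ w ∈ Metric.ball z₀ R, ‖F w‖ = ‖F z₀‖ * Real.exp (G w).re := by
    intro w hw
    rw [hFG w hw, norm_mul, Complex.norm_exp]
  set M := Real.log (‖F z₀‖ / c) with hM
  have hM0 : 0 < M := Real.log_pos ((one_lt_div hc).2 hz₀)
  have hexpM : Real.exp M = ‖F z₀‖ / c := Real.exp_log (by positivity)
  have hmaps : MapsTo (fun ζ => -G (z₀ + ζ)) (Metric.ball 0 R) {v | v.re ≤ M} := by
    intro ζ hζ
    have h1 := hcF _ (hadd ζ hζ)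
    rw [hnorm _ (hadd ζ hζ)] at h1
    show (-G (z₀ + ζ)).re ≤ M
    rw [← Real.exp_le_exp, hexpM, Complex.neg_re, Real.exp_neg, le_div_iff₀ hc,
      inv_mul_le_iff₀ (Real.exp_pos _)]
    linarith
  have hdiff : DifferentiableOn ℂ (fun ζ => -G (z₀ + ζ)) (Metric.ball 0 R) :=
    (hGd.comp (by fun_prop) hadd).neg
  have hζn : ‖z - z₀‖ ≤ R / 2 := by rwa [← dist_eq_norm]
  have hζ : z - z₀ ∈ Metric.ball (0 : ℂ) R := by
    rw [mem_ball_zero_iff]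
    linarith
  have hbc := Complex.borelCaratheodory_zero hM0 hdiff hmaps hR hζ (by simp [hG0])
  rw [add_sub_cancel, norm_neg] at hbc
  have hle : ‖G z‖ ≤ 2 * M := by
    refine hbc.trans ?_
    rw [div_le_iff₀ (by linarith)]
    nlinarith
  have hzm : z ∈ Metric.ball z₀ R := by
    rw [Metric.mem_ball]
    linarith
  rw [hnorm z hzm]
  calc ‖F z₀‖ * Real.exp (G z).re ≤ ‖F z₀‖ * Real.exp (2 * M) := by
        gcongr
        exact (Complex.re_le_norm _).trans hle
    _ = ‖F z₀‖ * (‖F z₀‖ / c) ^ 2 := by rw [two_mul, Real.exp_add, hexpM, sq]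
    _ = ‖F z₀‖ ^ 3 / c ^ 2 := by ring

theorem isCompact_closure_range_of_equicontinuous {X : Type*} [TopologicalSpace X]
    [CompactlyCoherentSpace X] (F : ℕ → C(X, ℂ))
    (heq : Equicontinuous fun n => (F n : X → ℂ)) (hb : ∀ x, ∃ C, ∀ n, ‖F n x‖ ≤ C) :
    IsCompact (closure (range F)) := by
  refine ArzelaAscoli.isCompact_closure_of_isClosedEmbedding
    (F := fun f : C(X, ℂ) => (f : X → ℂ)) (𝔖 := {K | IsCompact K}) (fun K hK => hK) ?_ ?_ ?_
  · refine ⟨ContinuousMap.isUniformEmbedding_toUniformOnFunIsCompact.isEmbedding, ?_⟩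
    have := UniformOnFun.isClosed_setOfPred_continuous (α := X) (β := ℂ)
      CompactlyCoherentSpace.isCoherentWith
    have h2 := ContinuousMap.range_toUniformOnFunIsCompact (α := X) (β := ℂ)
    exact (congrArg IsClosed h2).mpr this
  · intro K _
    refine Equicontinuous.equicontinuousOn ?_ K
    intro x V hV
    filter_upwards [heq x V hV] with y hy
    rintro ⟨_, n, rfl⟩
    exact hy n
  · intro K _ x _
    obtain ⟨C, hC⟩ := hb x
    refine ⟨Metric.closedBall 0 C, isCompact_closedBall 0 C, ?_⟩
    rintro _ ⟨n, rfl⟩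
    simpa using hC n

/-- **Montel's theorem** for a sequence of holomorphic functions that is locally eventually
bounded. -/
theorem exists_subseq_tendsto_of_locally_bounded {U : Set ℂ} (hU : IsOpen U) {f : ℕ → ℂ → ℂ}
    (hf : ∀ n, DifferentiableOn ℂ (f n) U)
    (hb : ∀ z ∈ U, ∃ C : ℝ, ∀ᶠ p : ℕ × ℂ in atTop ×ˢ 𝓝 z, ‖f p.1 p.2‖ ≤ C) :
    ∃ φ : ℕ → ℕ, StrictMono φ ∧ ∃ g : ℂ → ℂ, DifferentiableOn ℂ g U ∧
      ∀ z ∈ U, Tendsto (fun p : ℕ × ℂ => f (φ p.1) p.2) (atTop ×ˢ 𝓝 z) (𝓝 (g z)) := by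
  have hball : ∀ z ∈ U, ∃ r > 0, ∃ C, Metric.ball z r ⊆ U ∧ ∀ n, ∀ w ∈ Metric.ball z r,
      ‖f n w‖ ≤ C := by
    intro z hz
    obtain ⟨C, hC⟩ := hb z hz
    obtain ⟨P, hP, Q, hQ, hPQ⟩ := Filter.eventually_prod_iff.1 hC
    obtain ⟨N, hN⟩ := eventually_atTop.1 hP
    have h1 : ∀ᶠ w in 𝓝 z, ∀ n ∈ Finset.range N, ‖f n w‖ ≤ ‖f n z‖ + 1 := by
      rw [Finset.eventually_all]
      intro n _
      have := ((hf n).differentiableAt (hU.mem_nhds hz)).continuousAt.norm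
      filter_upwards [this.eventually_lt_const (show ‖f n z‖ < ‖f n z‖ + 1 by linarith)] with w hw
      exact hw.le
    have h2 : ∀ᶠ w in 𝓝 z, w ∈ U ∧ Q w ∧ ∀ n ∈ Finset.range N, ‖f n w‖ ≤ ‖f n z‖ + 1 := by
      filter_upwards [hU.mem_nhds hz, hQ, h1] with w a b c using ⟨a, b, c⟩
    obtain ⟨r, hr, hrs⟩ := Metric.nhds_basis_ball.mem_iff.1 h2
    refine ⟨r, hr, max C (∑ n ∈ Finset.range N, (‖f n z‖ + 1)), fun w hw => (hrs hw).1,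
      fun n w hw => ?_⟩
    rcases lt_or_ge n N with h | h
    · refine le_max_of_le_right (((hrs hw).2.2 n (Finset.mem_range.2 h)).trans ?_)
      exact Finset.single_le_sum (f := fun n => ‖f n z‖ + 1) (fun _ _ => by positivity)
        (Finset.mem_range.2 h)
    · exact le_max_of_le_left (hPQ (hN n h) (hrs hw).2.1)
  have : LocallyCompactSpace U := hU.locallyCompactSpace
  set F : ℕ → C(U, ℂ) := fun n => ⟨U.domRestrict (f n), (hf n).continuousOn.domRestrict⟩ with hF
  have heq : Equicontinuous fun n => (F n : U → ℂ) := by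
    intro z
    obtain ⟨r, hr, C, hrU, hC⟩ := hball z z.2
    refine Metric.equicontinuousAt_of_continuity_modulus
      (fun w : U => 2 * C / r * dist w z) ?_ _ ?_
    · have : Continuous fun w : U => 2 * C / r * dist w z := by fun_prop
      simpa using this.tendsto z
    · filter_upwards [Metric.ball_mem_nhds z hr] with w hw n
      rw [dist_comm]
      refine Complex.dist_le_div_mul_dist_of_mapsTo_ball (f := f n) ((hf n).mono hrU) ?_ hw
      intro v hv
      rw [mem_closedBall_iff_norm]
      have := norm_sub_le (f n v) (f n z)
      linarith [hC n v hv, hC n z (Metric.mem_ball_self hr)]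
  have hcomp := isCompact_closure_range_of_equicontinuous F heq fun z => by
    obtain ⟨r, hr, C, hrU, hC⟩ := hball z z.2
    exact ⟨C, fun n => hC n z (Metric.mem_ball_self hr)⟩
  obtain ⟨g, -, φ, hφ, hg⟩ := hcomp.tendsto_subseq fun n => subset_closure (mem_range_self n)
  have hlu := ContinuousMap.tendsto_iff_tendstoLocallyUniformly.1 hg
  set g' : ℂ → ℂ := Function.extend ((↑) : U → ℂ) g 0 with hg'
  have hgg : ∀ z : U, g' z = g z := fun z => Subtype.val_injective.extend_apply _ _ _
  have hlu' : TendstoLocallyUniformlyOn (fun n => f (φ n)) g' atTop U := by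
    rw [tendstoLocallyUniformlyOn_iff_tendstoLocallyUniformly_comp_coe]
    have : g' ∘ ((↑) : U → ℂ) = g := funext hgg
    rw [this]
    exact hlu
  have hgd := hlu'.differentiableOn (Eventually.of_forall fun n => hf (φ n)) hU
  exact ⟨φ, hφ, g', hgd,
    (hU.tendstoLocallyUniformlyOn_iff_tendsto_prod hgd.continuousOn).1 hlu'⟩

theorem exists_pos_lt_forall_sphere_ne_zero {h : ℂ → ℂ} {z₀ : ℂ} {R : ℝ} (hR : 0 < R)
    (hd : DifferentiableOn ℂ h (Metric.ball z₀ R)) (hnc : ∀ c, ¬ ∀ᶠ w in 𝓝 z₀, h w = c) :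
    ∃ r, 0 < r ∧ r < R ∧ ∀ w ∈ Metric.sphere z₀ r, h w ≠ 0 ∧ deriv h w ≠ 0 := by
  have hz₀ := Metric.ball_mem_nhds z₀ hR
  have h1 : ∀ᶠ w in 𝓝[≠] z₀, h w ≠ 0 :=
    (hd.analyticAt hz₀).eventually_eq_zero_or_eventually_ne_zero.resolve_left (hnc 0)
  have h2 : ∀ᶠ w in 𝓝[≠] z₀, deriv h w ≠ 0 := by
    refine (hd.analyticAt hz₀).deriv.eventually_eq_zero_or_eventually_ne_zero.resolve_left ?_
    intro h0
    obtain ⟨ε, hε, hball⟩ := Metric.mem_nhds_iff.1 (Filter.inter_mem h0 hz₀)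
    refine hnc (h z₀) ?_
    filter_upwards [Metric.ball_mem_nhds z₀ hε] with w hw
    exact Metric.isOpen_ball.is_const_of_deriv_eq_zero (convex_ball z₀ ε).isPreconnected
      (hd.mono fun v hv => (hball hv).2) (fun v hv => (hball hv).1) hw (Metric.mem_ball_self hε)
  obtain ⟨ε, hε, hball⟩ := Metric.mem_nhdsWithin_iff.1 (h1.and h2)
  refine ⟨min ε R / 2, by positivity, by linarith [min_le_right ε R], fun w hw => ?_⟩
  have hp : 0 < min ε R := lt_min hε hR
  refine hball ⟨?_, ?_⟩
  · rw [Metric.mem_ball, Metric.mem_sphere.1 hw]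
    linarith [min_le_left ε R]
  · rintro rfl
    rw [Metric.mem_sphere, dist_self] at hw
    linarith

theorem norm_le_of_forall_mem_sphere {f : ℂ → ℂ} {z₀ : ℂ} {r R C : ℝ} (hr : 0 < r) (hrR : r < R)
    (hf : DifferentiableOn ℂ f (Metric.ball z₀ R)) (hC : ∀ w ∈ Metric.sphere z₀ r, ‖f w‖ ≤ C)
    {w : ℂ} (hw : w ∈ Metric.closedBall z₀ r) : ‖f w‖ ≤ C := by
  refine Complex.norm_le_of_forall_mem_frontier_norm_le (Metric.isBounded_ball (x := z₀) (r := r))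
    ?_ ?_ ?_
  · refine (hf.mono ?_).diffContOnCl
    rw [closure_ball z₀ hr.ne']
    exact Metric.closedBall_subset_ball hrR
  · rwa [frontier_ball z₀ hr.ne']
  · rwa [closure_ball z₀ hr.ne']

namespace LocalChart

variable {m : ℕ} {U : Set ℂ} {T : ℕ → WeierstrassTriple m U} {z₀ : ℂ}

theorem tendsto_deriv (c : LocalChart T z₀) {z : ℂ} (hz : z ∈ Metric.ball z₀ c.R) :
    Tendsto (fun p : ℕ × ℂ => deriv (c.H p.1) p.2) (atTop ×ˢ 𝓝 z) (𝓝 (deriv c.h z)) := by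
  have h1 := (Metric.isOpen_ball.tendstoLocallyUniformlyOn_iff_tendsto_prod
    c.h_diff.continuousOn).2 c.tendsto
  have h2 := h1.deriv (eventually_atTop.2 ⟨c.N, c.H_diff⟩) Metric.isOpen_ball
  exact (Metric.isOpen_ball.tendstoLocallyUniformlyOn_iff_tendsto_prod
    (c.h_diff.deriv Metric.isOpen_ball).continuousOn).1 h2 z hz

theorem eventually_ge (c : LocalChart T z₀) : ∀ᶠ n in atTop, c.N ≤ n := eventually_ge_atTop _

theorem eventually_prod_ge (c : LocalChart T z₀) {z : ℂ} (hz : z ∈ Metric.ball z₀ c.R) :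
    ∀ᶠ p : ℕ × ℂ in atTop ×ˢ 𝓝 z, c.N ≤ p.1 ∧ p.2 ∈ Metric.ball z₀ c.R :=
  c.eventually_ge.prod_mk (Metric.isOpen_ball.eventually_mem hz)

theorem mem_self (c : LocalChart T z₀) : z₀ ∈ Metric.ball z₀ c.R := Metric.mem_ball_self c.R_pos

theorem F_ne_zero (c : LocalChart T z₀) {n : ℕ} (hn : c.N ≤ n) {w : ℂ}
    (hw : w ∈ Metric.ball z₀ c.R) : c.F n w ≠ 0 := by
  intro h
  have := (T n).lam_pos w (c.ball_subset hw)
  rw [c.lam_eq n hn w hw, h, norm_zero, mul_zero] at this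
  exact this.false

theorem tendsto_weight (c : LocalChart T z₀) {z : ℂ} (hz : z ∈ Metric.ball z₀ c.R) :
    Tendsto (fun p : ℕ × ℂ => (1 + ‖c.H p.1 p.2‖ ^ 2) ^ ((m : ℝ) / 2)) (atTop ×ˢ 𝓝 z)
      (𝓝 ((1 + ‖c.h z‖ ^ 2) ^ ((m : ℝ) / 2))) :=
  (((c.tendsto z hz).norm.pow 2).const_add 1).rpow_const (Or.inl (by positivity))

theorem norm_F_le_lam (c : LocalChart T z₀) {n : ℕ} (hn : c.N ≤ n) {w : ℂ}
    (hw : w ∈ Metric.ball z₀ c.R) : ‖c.F n w‖ ≤ (T n).lam w := by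
  rw [c.lam_eq n hn w hw]
  refine le_mul_of_one_le_left (norm_nonneg _) (Real.one_le_rpow ?_ (by positivity))
  linarith [sq_nonneg ‖c.H n w‖]

theorem exists_forall_lt_norm_F (c : LocalChart T z₀) (hm : 0 < m) {B : ℝ}
    (hB : ∀ n, ∀ z ∈ U, |(T n).curv z| ≤ B) :
    ∃ r, 0 < r ∧ r < c.R ∧ ∃ c₀ > 0, ∀ᶠ n in atTop, ∀ w ∈ Metric.closedBall z₀ r,
      c₀ < ‖c.F n w‖ := by
  obtain ⟨r, hr, hrR, hne⟩ := exists_pos_lt_forall_sphere_ne_zero c.R_pos c.h_diff c.h_nonconst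
  have hcb : Metric.closedBall z₀ r ⊆ Metric.ball z₀ c.R := Metric.closedBall_subset_ball hrR
  have hsb : Metric.sphere z₀ r ⊆ Metric.ball z₀ c.R :=
    Metric.sphere_subset_closedBall.trans hcb
  set B' := max B 1
  have hB' : 0 < B' := lt_max_of_lt_right one_pos
  set q : ℂ → ℝ := fun w => Real.sqrt (2 * m / B') *
    (‖deriv c.h w‖ / (1 + ‖c.h w‖ ^ 2)) / (1 + ‖c.h w‖ ^ 2) ^ ((m : ℝ) / 2) with hq
  have hqc : ContinuousOn q (Metric.sphere z₀ r) := by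
    have h1 : ContinuousOn c.h (Metric.sphere z₀ r) := c.h_diff.continuousOn.mono hsb
    have h2 : ContinuousOn (deriv c.h) (Metric.sphere z₀ r) :=
      (c.h_diff.deriv Metric.isOpen_ball).continuousOn.mono hsb
    have h3 : ContinuousOn (fun w => 1 + ‖c.h w‖ ^ 2) (Metric.sphere z₀ r) := by fun_prop
    exact (continuousOn_const.mul (h2.norm.div h3 fun w _ => by positivity)).div
      (h3.rpow_const fun w _ => Or.inl (by positivity)) fun w _ => by positivity
  have hq0 : ∀ w ∈ Metric.sphere z₀ r, 0 < q w := by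
    intro w hw
    have := norm_pos_iff.2 (hne w hw).2
    have : (0 : ℝ) < m := by exact_mod_cast hm
    positivity
  obtain ⟨w₀, hw₀, hmin⟩ := (isCompact_sphere z₀ r).exists_isMinOn
    (NormedSpace.sphere_nonempty.2 hr.le) hqc
  have hlow : ∀ᶠ n in atTop, ∀ w ∈ Metric.sphere z₀ r, q w₀ / 2 < ‖c.F n w‖ := by
    refine (isCompact_sphere z₀ r).eventually_forall_of_prod fun w hw => ?_
    have hqw := hq0 w₀ hw₀
    have hlt : q w₀ / 2 < q w := by
      have : q w₀ ≤ q w := hmin hw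
      linarith
    have ht : Tendsto (fun p : ℕ × ℂ => Real.sqrt (2 * m / B') *
        (‖deriv (c.H p.1) p.2‖ / (1 + ‖c.H p.1 p.2‖ ^ 2)) /
          (1 + ‖c.H p.1 p.2‖ ^ 2) ^ ((m : ℝ) / 2)) (atTop ×ˢ 𝓝 w) (𝓝 (q w)) := by
      refine (((c.tendsto_deriv (hsb hw)).norm.div (((c.tendsto w (hsb hw)).norm.pow 2).const_add 1)
        (by positivity)).const_mul _).div (c.tendsto_weight (hsb hw)) (by positivity)
    filter_upwards [ht.eventually_const_lt hlt, c.eventually_prod_ge (hsb hw)] with p hp hpN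
    refine hp.trans_le ?_
    have hlam := (T p.1).lam_pos p.2 (c.ball_subset hpN.2)
    have hcurv := hB p.1 p.2 (c.ball_subset hpN.2)
    rw [WeierstrassTriple.curv, abs_div, abs_mul, abs_neg, abs_of_nonneg (sq_nonneg (sphD _ _)),
      abs_of_nonneg (sq_nonneg ((T p.1).lam _)), abs_of_nonneg (by positivity : (0:ℝ) ≤ 2 * m),
      div_le_iff₀ (by positivity)] at hcurv
    have h3 : 2 * m * sphD (T p.1).g p.2 ^ 2 ≤ B' * (T p.1).lam p.2 ^ 2 :=
      hcurv.trans (by gcongr; exact le_max_left _ _)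
    rw [div_le_iff₀ (by positivity), mul_comm ‖_‖, ← c.lam_eq _ hpN.1 _ hpN.2,
      ← c.sphD_eq _ hpN.1 _ hpN.2]
    refine le_of_sq_le_sq ?_ hlam.le
    rw [mul_pow, Real.sq_sqrt (by positivity), div_mul_eq_mul_div, div_le_iff₀ hB']
    linarith
  refine ⟨r, hr, hrR, q w₀ / 4, by linarith [hq0 w₀ hw₀], ?_⟩
  filter_upwards [hlow, c.eventually_ge] with n hn hN w hw
  have hqw := hq0 w₀ hw₀
  have hinv := norm_le_of_forall_mem_sphere (f := fun v => (c.F n v)⁻¹) (C := (q w₀ / 2)⁻¹) hr hrR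
    ((c.F_diff n hN).inv fun v hv => c.F_ne_zero hN hv) (fun v hv => by
      rw [norm_inv]
      exact inv_anti₀ (by positivity) (hn v hv).le) hw
  rw [norm_inv, inv_le_inv₀ (norm_pos_iff.2 (c.F_ne_zero hN (hcb hw))) (by positivity)] at hinv
  linarith

theorem exists_pos_eventually_le_lam (c : LocalChart T z₀) (hm : 0 < m) {B : ℝ}
    (hB : ∀ n, ∀ z ∈ U, |(T n).curv z| ≤ B) :
    ∃ c₀ > 0, ∀ᶠ p : ℕ × ℂ in atTop ×ˢ 𝓝 z₀, c₀ ≤ (T p.1).lam p.2 := by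
  obtain ⟨r, hr, -, c₀, hc₀, hlow⟩ := c.exists_forall_lt_norm_F hm hB
  refine ⟨c₀, hc₀, ?_⟩
  filter_upwards [hlow.prod_mk (Metric.closedBall_mem_nhds z₀ hr), c.eventually_prod_ge c.mem_self]
    with p hp hpN
  exact (hp.1 _ hp.2).le.trans (c.norm_F_le_lam hpN.1 hpN.2)

theorem exists_lam_le_pow_three (c : LocalChart T z₀) (hm : 0 < m) {B : ℝ}
    (hB : ∀ n, ∀ z ∈ U, |(T n).curv z| ≤ B) :
    ∃ V ∈ 𝓝 z₀, V ⊆ U ∧ ∃ C > 0, ∀ᶠ n in atTop, ∀ z ∈ V, ∀ w ∈ V,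
      (T n).lam z ≤ C * (T n).lam w ^ 3 := by
  obtain ⟨r, hr, hrR, c₀, hc₀, hlow⟩ := c.exists_forall_lt_norm_F hm hB
  set D := (1 + ‖c.h z₀‖ ^ 2) ^ ((m : ℝ) / 2) + 1 with hD
  have hD0 : 0 < D := by positivity
  obtain ⟨P, hP, Q, hQ, hPQ⟩ := Filter.eventually_prod_iff.1
    ((c.tendsto_weight c.mem_self).eventually_lt_const (lt_add_one _))
  have hQn : {w | Q w} ∈ 𝓝 z₀ := hQ
  have h8 : Metric.ball z₀ (r / 8) ⊆ Metric.ball z₀ r := Metric.ball_subset_ball (by linarith)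
  have hrb : Metric.ball z₀ r ⊆ Metric.ball z₀ c.R := Metric.ball_subset_ball hrR.le
  refine ⟨Metric.ball z₀ (r / 8) ∩ {w | Q w},
    Filter.inter_mem (Metric.ball_mem_nhds z₀ (by positivity)) hQn,
    fun w hw => c.ball_subset (hrb (h8 hw.1)), D / c₀ ^ 2, by positivity, ?_⟩
  filter_upwards [hlow, hP, c.eventually_ge] with n hn hPn hN z hz w hw
  have hsub : Metric.ball w (r / 2) ⊆ Metric.ball z₀ r := by
    refine Metric.ball_subset_ball' ?_
    have := Metric.mem_ball.1 hw.1
    linarith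
  have hzw : dist z w ≤ r / 2 / 2 := by
    have := dist_triangle_right z w z₀
    have := Metric.mem_ball.1 hw.1
    have := Metric.mem_ball.1 hz.1
    linarith
  have hF := norm_le_pow_three_div_of_lt_norm (F := c.F n) (half_pos hr) hc₀
    ((c.F_diff n hN).mono (hsub.trans hrb))
    (fun v hv => hn v (Metric.ball_subset_closedBall (hsub hv))) hzw
  have hFw := c.norm_F_le_lam hN (hrb (h8 hw.1))
  rw [c.lam_eq n hN z (hrb (h8 hz.1))]
  calc (1 + ‖c.H n z‖ ^ 2) ^ ((m : ℝ) / 2) * ‖c.F n z‖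
      ≤ D * (‖c.F n w‖ ^ 3 / c₀ ^ 2) := by
        gcongr
        exact (hPQ hPn hz.2).le
    _ ≤ D * ((T n).lam w ^ 3 / c₀ ^ 2) := by gcongr
    _ = D / c₀ ^ 2 * (T n).lam w ^ 3 := by ring

theorem exists_eventually_sphD_le (c : LocalChart T z₀) :
    ∃ C, ∀ᶠ p : ℕ × ℂ in atTop ×ˢ 𝓝 z₀,
      0 ≤ sphD (T p.1).g p.2 ∧ sphD (T p.1).g p.2 ≤ C := by
  refine ⟨‖deriv c.h z₀‖ + 1, ?_⟩
  filter_upwards [(c.tendsto_deriv c.mem_self).norm.eventually_lt_const (lt_add_one _),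
    c.eventually_prod_ge c.mem_self] with p hp hpN
  rw [c.sphD_eq _ hpN.1 _ hpN.2]
  refine ⟨by positivity, (div_le_self (norm_nonneg _) ?_).trans hp.le⟩
  linarith [sq_nonneg ‖c.H p.1 p.2‖]

theorem exists_tendsto_lam (c : LocalChart T z₀) {f : ℂ → ℂ}
    (hf : DifferentiableOn ℂ f U)
    (hconv : ∀ z ∈ U, Tendsto (fun p : ℕ × ℂ => (T p.1).f p.2) (atTop ×ˢ 𝓝 z) (𝓝 (f z))) :
    ∃ L, Tendsto (fun p : ℕ × ℂ => (T p.1).lam p.2) (atTop ×ˢ 𝓝 z₀) (𝓝 L) := by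
  obtain ⟨r, hr, hrR, hne⟩ := exists_pos_lt_forall_sphere_ne_zero c.R_pos c.h_diff c.h_nonconst
  have hcb : Metric.closedBall z₀ r ⊆ Metric.ball z₀ c.R := Metric.closedBall_subset_ball hrR
  have hsb : Metric.sphere z₀ r ⊆ Metric.ball z₀ c.R :=
    Metric.sphere_subset_closedBall.trans hcb
  have hsphere : ∀ ε > 0, ∀ᶠ n in atTop, ∀ w ∈ Metric.sphere z₀ r,
      dist (c.F n w) (f w / c.h w ^ c.k) < ε := by
    intro ε hε
    refine (isCompact_sphere z₀ r).eventually_forall_of_prod fun w hw => ?_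
    have hwR := hsb hw
    have hh0 := (hne w hw).1
    have hwU := c.ball_subset hwR
    have hfc : ContinuousAt (fun v => f v / c.h v ^ c.k) w :=
      (hf.differentiableAt ((T 0).isOpen.mem_nhds hwU)).continuousAt.div
        ((c.h_diff.differentiableAt (Metric.isOpen_ball.mem_nhds hwR)).continuousAt.pow _)
        (pow_ne_zero _ hh0)
    have h1 : Tendsto (fun p : ℕ × ℂ => f p.2 / c.h p.2 ^ c.k) (atTop ×ˢ 𝓝 w)
        (𝓝 (f w / c.h w ^ c.k)) := hfc.tendsto.comp tendsto_snd
    have h2 : Tendsto (fun p : ℕ × ℂ => (T p.1).f p.2 / c.H p.1 p.2 ^ c.k) (atTop ×ˢ 𝓝 w)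
        (𝓝 (f w / c.h w ^ c.k)) :=
      (hconv w hwU).div ((c.tendsto w hwR).pow _) (pow_ne_zero _ hh0)
    have h3 := h2.dist h1
    rw [dist_self] at h3
    filter_upwards [h3.eventually_lt_const hε, c.eventually_prod_ge hwR,
      (c.tendsto w hwR).eventually_ne hh0] with p hp hpN hH
    rwa [c.f_eq _ hpN.1 _ hpN.2, mul_div_assoc, div_self (pow_ne_zero _ hH), mul_one] at hp
  have hcauchy : UniformCauchySeqOn c.F atTop (Metric.closedBall z₀ r) := by
    rw [Metric.uniformCauchySeqOn_iff]
    intro ε hε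
    obtain ⟨N, hN⟩ := eventually_atTop.1 (hsphere (ε / 3) (by positivity))
    refine ⟨max N c.N, fun n hn n' hn' w hw => ?_⟩
    rw [dist_eq_norm]
    refine (norm_le_of_forall_mem_sphere (f := fun v => c.F n v - c.F n' v) (C := 2 * (ε / 3))
      hr hrR ((c.F_diff n (le_of_max_le_right hn)).sub (c.F_diff n' (le_of_max_le_right hn')))
      (fun v hv => ?_) hw).trans_lt (by linarith)
    rw [← dist_eq_norm]
    have := dist_triangle_right (c.F n v) (c.F n' v) (f v / c.h v ^ c.k)
    linarith [hN n (le_of_max_le_left hn) v hv, hN n' (le_of_max_le_left hn') v hv]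
  have hlim : ∀ w ∈ Metric.closedBall z₀ r, ∃ L, Tendsto (fun n => c.F n w) atTop (𝓝 L) :=
    fun w hw => cauchySeq_tendsto_of_complete (hcauchy.cauchySeq hw)
  choose! G hG using hlim
  have hunif := hcauchy.tendstoUniformlyOn_of_tendsto hG
  have hGc : ContinuousOn G (Metric.closedBall z₀ r) := by
    refine hunif.continuousOn (Eventually.frequently ?_)
    filter_upwards [c.eventually_ge] with n hn
    exact (c.F_diff n hn).continuousOn.mono hcb
  have hnb := Metric.closedBall_mem_nhds z₀ hr
  have hF : Tendsto (fun p : ℕ × ℂ => c.F p.1 p.2) (atTop ×ˢ 𝓝 z₀) (𝓝 (G z₀)) := by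
    refine tendsto_prod_of_forall_eventually_dist_lt hnb (hGc.continuousAt hnb) fun ε hε => ?_
    filter_upwards [Metric.tendstoUniformlyOn_iff.1 hunif ε hε] with n hn w hw
    rw [dist_comm]
    exact hn w hw
  refine ⟨_, ((c.tendsto_weight c.mem_self).mul hF.norm).congr' ?_⟩
  filter_upwards [c.eventually_prod_ge c.mem_self] with p hp
  exact (c.lam_eq _ hp.1 _ hp.2).symm

end LocalChart

theorem SphLocUnifOn.comp_strictMono {F : ℕ → ℂ → OnePoint ℂ} {f : ℂ → OnePoint ℂ} {U : Set ℂ}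
    (h : SphLocUnifOn F f U) {φ : ℕ → ℕ} (hφ : StrictMono φ) :
    SphLocUnifOn (fun n => F (φ n)) f U :=
  fun K hKU hK ε hε => hφ.tendsto_atTop.eventually (h K hKU hK ε hε)

/-- Densities at two points of the domain control each other polynomially, uniformly along the
sequence. -/
theorem exists_lam_le_mul_pow {m : ℕ} {U : Set ℂ} {T : ℕ → WeierstrassTriple m U}
    (hm : 0 < m) {B : ℝ} (hB : ∀ n, ∀ z ∈ U, |(T n).curv z| ≤ B)
    (hchart : ∀ z ∈ U, Nonempty (LocalChart T z)) {x y : ℂ} (hx : x ∈ U) (hy : y ∈ U) :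
    ∃ C > 0, ∃ k : ℕ, ∀ᶠ n in atTop, (T n).lam x ≤ C * (T n).lam y ^ k := by
  refine (T 0).isConnected.isPreconnected.induction₂'
    (fun x y => ∃ C > 0, ∃ k : ℕ, ∀ᶠ n in atTop, (T n).lam x ≤ C * (T n).lam y ^ k) ?_ ?_ hx hy
  · intro x hx
    obtain ⟨c⟩ := hchart x hx
    obtain ⟨V, hV, -, C, hC, h⟩ := c.exists_lam_le_pow_three hm hB
    filter_upwards [nhdsWithin_le_nhds hV] with y hyV
    exact ⟨⟨C, hC, 3, h.mono fun n hn => hn x (mem_of_mem_nhds hV) y hyV⟩,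
      ⟨C, hC, 3, h.mono fun n hn => hn y hyV x (mem_of_mem_nhds hV)⟩⟩
  · rintro x y z hx hy hz ⟨C, hC, k, h⟩ ⟨C', hC', k', h'⟩
    refine ⟨C * C' ^ k, by positivity, k' * k, ?_⟩
    filter_upwards [h, h'] with n hn hn'
    have := (T n).lam_pos y hy
    calc (T n).lam x ≤ C * (T n).lam y ^ k := hn
      _ ≤ C * (C' * (T n).lam z ^ k') ^ k := by gcongr
      _ = C * C' ^ k * (T n).lam z ^ (k' * k) := by ring

theorem realLocUnifOn_curv_of_tendsto_atTop {m : ℕ} {U : Set ℂ} {T : ℕ → WeierstrassTriple m U}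
    (hm : 0 < m) {B : ℝ} (hB : ∀ n, ∀ z ∈ U, |(T n).curv z| ≤ B)
    (hchart : ∀ z ∈ U, Nonempty (LocalChart T z)) {p : ℂ} (hp : p ∈ U)
    (hlim : Tendsto (fun n => (T n).lam p) atTop atTop) :
    RealLocUnifOn (fun n => (T n).curv) (fun _ => 0) U := by
  intro K hKU hK ε hε
  refine hK.eventually_forall_of_prod fun z₀ hz₀K => ?_
  have hz₀ := hKU hz₀K
  obtain ⟨c⟩ := hchart z₀ hz₀
  obtain ⟨D, hD⟩ := c.exists_eventually_sphD_le
  obtain ⟨V, hV, hVU, C, hC, hHar⟩ := c.exists_lam_le_pow_three hm hB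
  obtain ⟨C', hC', k, hk⟩ := exists_lam_le_mul_pow hm hB hchart hp hz₀
  set b := Real.sqrt (2 * m * D ^ 2 / ε) + 1 with hb
  have hb0 : 0 < b := by positivity
  have hbD : 2 * m * D ^ 2 < ε * b ^ 2 := by
    have h1 := Real.sq_sqrt (show 0 ≤ 2 * m * D ^ 2 / ε by positivity)
    have h2 := Real.sqrt_nonneg (2 * m * D ^ 2 / ε)
    have h3 : 2 * m * D ^ 2 / ε < b ^ 2 := by nlinarith
    rw [div_lt_iff₀ hε] at h3
    linarith
  have hbig : ∀ᶠ n in atTop, ∀ w ∈ V, b < (T n).lam w := by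
    filter_upwards [hHar, hk, hlim.eventually_gt_atTop (C' * (C * b ^ 3) ^ k)] with n h1 h2 h3 w hw
    by_contra! hle
    have hw0 := (T n).lam_pos w (hVU hw)
    have hz0 := (T n).lam_pos z₀ hz₀
    have h4 : (T n).lam z₀ ≤ C * b ^ 3 := (h1 z₀ (mem_of_mem_nhds hV) w hw).trans (by gcongr)
    have h5 : (T n).lam p ≤ C' * (C * b ^ 3) ^ k := h2.trans (by gcongr)
    linarith
  filter_upwards [hD, hbig.prod_mk hV] with q hq hqb
  have hlt := hqb.1 _ hqb.2
  have hlam := (T q.1).lam_pos q.2 (hVU hqb.2)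
  rw [sub_zero, WeierstrassTriple.curv, abs_div, abs_mul, abs_neg,
    abs_of_nonneg (sq_nonneg (sphD _ _)), abs_of_nonneg (sq_nonneg ((T q.1).lam _)),
    abs_of_nonneg (by positivity : (0 : ℝ) ≤ 2 * m), div_lt_iff₀ (by positivity)]
  calc 2 * m * sphD (T q.1).g q.2 ^ 2 ≤ 2 * m * D ^ 2 := by
        have := hq.1
        gcongr
        exact hq.2
    _ < ε * b ^ 2 := hbD
    _ ≤ ε * (T q.1).lam q.2 ^ 2 := by gcongr

theorem exists_subseq_f_tendsto {m : ℕ} {U : Set ℂ} {T : ℕ → WeierstrassTriple m U}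
    (hm : 0 < m) {B : ℝ} (hB : ∀ n, ∀ z ∈ U, |(T n).curv z| ≤ B)
    (hchart : ∀ z ∈ U, Nonempty (LocalChart T z)) {p : ℂ} (hp : p ∈ U) {A : ℝ}
    (hA : ∀ n, (T n).lam p ≤ A) :
    ∃ φ : ℕ → ℕ, StrictMono φ ∧ ∃ f : ℂ → ℂ, DifferentiableOn ℂ f U ∧
      ∀ z ∈ U, Tendsto (fun q : ℕ × ℂ => (T (φ q.1)).f q.2) (atTop ×ˢ 𝓝 z) (𝓝 (f z)) := by
  refine exists_subseq_tendsto_of_locally_bounded (f := fun n => (T n).f) (T 0).isOpen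
    (fun n => (T n).f_holo) fun z₀ hz₀ => ?_
  obtain ⟨c⟩ := hchart z₀ hz₀
  obtain ⟨V, hV, hVU, C, hC, hHar⟩ := c.exists_lam_le_pow_three hm hB
  obtain ⟨C', hC', k, hk⟩ := exists_lam_le_mul_pow hm hB hchart hz₀ hp
  refine ⟨C * (C' * A ^ k) ^ 3, ?_⟩
  filter_upwards [(hHar.and hk).prod_mk hV, c.eventually_prod_ge c.mem_self] with q hq hqN
  have hz0 := (T q.1).lam_pos z₀ hz₀
  have hp0 := (T q.1).lam_pos p hp
  calc ‖(T q.1).f q.2‖ ≤ (T q.1).lam q.2 := c.f_le _ hqN.1 _ hqN.2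
    _ ≤ C * (T q.1).lam z₀ ^ 3 := hq.1.1 _ hq.2 _ (mem_of_mem_nhds hV)
    _ ≤ C * (C' * (T q.1).lam p ^ k) ^ 3 := by
      gcongr
      exact hq.1.2
    _ ≤ C * (C' * A ^ k) ^ 3 := by
      gcongr
      exact hA _

theorem SphLocUnifOn.tendsto_of_eq_coe {F : ℕ → ℂ → OnePoint ℂ} {f : ℂ → OnePoint ℂ} {U : Set ℂ}
    (h : SphLocUnifOn F f U) {z : ℂ} (hz : z ∈ U) {w : ℂ} (hw : f z = (w : OnePoint ℂ)) :
    (∀ᶠ n in atTop, F n z ≠ OnePoint.infty) ∧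
      Tendsto (fun n => sphFin (F n z)) atTop (𝓝 w) := by
  set S := Real.sqrt (1 + ‖w‖ ^ 2) with hS
  have hS0 : 0 < S := Real.sqrt_pos.2 (by positivity)
  have hclose : ∀ ε > 0, ε * S ≤ 1 / 2 → ∀ᶠ n in atTop,
      F n z ≠ OnePoint.infty ∧ ‖sphFin (F n z) - w‖ ≤ 2 * ε * S ^ 2 := by
    intro ε hε hεS
    filter_upwards [h {z} (singleton_subset_iff.2 hz) isCompact_singleton ε hε] with n hn
    refine norm_sphFin_sub_le le_rfl hεS ?_
    rw [← hw]
    exact hn z rfl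
  refine ⟨(hclose (1 / (2 * S)) (by positivity) (by field_simp; rfl)).mono fun n hn => hn.1, ?_⟩
  rw [Metric.tendsto_nhds]
  intro ε hε
  have h1 : 0 < min (1 / (2 * S)) (ε / (4 * S ^ 2)) := by positivity
  have h2 : min (1 / (2 * S)) (ε / (4 * S ^ 2)) * S ≤ 1 / 2 := by
    calc min (1 / (2 * S)) (ε / (4 * S ^ 2)) * S ≤ 1 / (2 * S) * S := by
          gcongr
          exact min_le_left _ _
      _ = 1 / 2 := by field_simp
  filter_upwards [hclose _ h1 h2] with n hn
  rw [dist_eq_norm]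
  refine hn.2.trans_lt ?_
  calc 2 * min (1 / (2 * S)) (ε / (4 * S ^ 2)) * S ^ 2 ≤ 2 * (ε / (4 * S ^ 2)) * S ^ 2 := by
        gcongr
        exact min_le_right _ _
    _ = ε / 2 := by
        field_simp
        norm_num
    _ < ε := half_lt_self hε

theorem continuousAt_of_forall_tendsto_prod {F : ℕ → ℂ → ℝ} {f : ℂ → ℝ} {U : Set ℂ}
    (hU : IsOpen U)
    (h : ∀ z ∈ U, Tendsto (fun p : ℕ × ℂ => F p.1 p.2) (atTop ×ˢ 𝓝 z) (𝓝 (f z))) {z : ℂ}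
    (hz : z ∈ U) : ContinuousAt f z := by
  rw [ContinuousAt, Metric.tendsto_nhds]
  intro ε hε
  obtain ⟨P, hP, Q, hQ, hPQ⟩ := Filter.eventually_prod_iff.1
    (Metric.tendsto_nhds.1 (h z hz) (ε / 2) (half_pos hε))
  filter_upwards [hQ, hU.mem_nhds hz] with w hw hwU
  have hlim : Tendsto (fun n => F n w) atTop (𝓝 (f w)) :=
    (h w hwU).comp (tendsto_id.prodMk tendsto_const_nhds)
  have := le_of_tendsto (hlim.dist tendsto_const_nhds) (hP.mono fun n hn => (hPQ hn hw).le)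
  linarith

/-- If the holomorphic forms converge, then so do the metrics, and the limit is a Weierstrass
triple. -/
theorem exists_limit_weierstrassTriple {m : ℕ} {U : Set ℂ} {T : ℕ → WeierstrassTriple m U}
    {g : ℂ → OnePoint ℂ} (hm : 0 < m) (hg : SphHolomorphicOn g U)
    (hnc : ∃ z ∈ U, ∃ w ∈ U, g z ≠ g w) (hconv : SphLocUnifOn (fun n => (T n).g) g U)
    {B : ℝ} (hB : ∀ n, ∀ z ∈ U, |(T n).curv z| ≤ B) {f : ℂ → ℂ} (hf : DifferentiableOn ℂ f U)
    (hfT : ∀ z ∈ U, Tendsto (fun p : ℕ × ℂ => (T p.1).f p.2) (atTop ×ˢ 𝓝 z) (𝓝 (f z))) :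
    ∃ S : WeierstrassTriple m U, (∀ z ∈ U, S.g z = g z) ∧
      RealLocUnifOn (fun n => (T n).lam) S.lam U := by
  have hchart : ∀ z ∈ U, Nonempty (LocalChart T z) :=
    fun z hz => nonempty_localChart T hg hnc hconv hz
  have hlim : ∀ z ∈ U, ∃ L, Tendsto (fun p : ℕ × ℂ => (T p.1).lam p.2) (atTop ×ˢ 𝓝 z) (𝓝 L) :=
    fun z hz => (hchart z hz).some.exists_tendsto_lam hf hfT
  choose! lam hlam using hlim
  have hcont : ∀ z ∈ U, ContinuousAt lam z := fun z hz =>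
    continuousAt_of_forall_tendsto_prod (F := fun n => (T n).lam) (T 0).isOpen hlam hz
  have hpt : ∀ z : ℂ, Tendsto (fun n : ℕ => (n, z)) atTop (atTop ×ˢ 𝓝 z) :=
    fun z => tendsto_id.prodMk tendsto_const_nhds
  refine ⟨⟨(T 0).isOpen, (T 0).isConnected, f, g, hf, hg, ?_, lam,
    fun z hz => (hcont z hz).continuousWithinAt, ?_, ?_⟩, fun z _ => rfl, ?_⟩
  · by_contra! hinf
    obtain ⟨z, hz, w, hw, hzw⟩ := hnc
    exact hzw ((hinf z hz).trans (hinf w hw).symm)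
  · intro z hz
    obtain ⟨c₀, hc₀, hc⟩ := (hchart z hz).some.exists_pos_eventually_le_lam hm hB
    exact hc₀.trans_le (ge_of_tendsto (hlam z hz) hc)
  · intro z hz w hw
    obtain ⟨hfin, hgw⟩ := hconv.tendsto_of_eq_coe hz hw
    have h1 : Tendsto (fun n => (1 + ‖sphFin ((T n).g z)‖ ^ 2) ^ ((m : ℝ) / 2) * ‖(T n).f z‖)
        atTop (𝓝 ((1 + ‖w‖ ^ 2) ^ ((m : ℝ) / 2) * ‖f z‖)) :=
      (((hgw.norm.pow 2).const_add 1).rpow_const (Or.inl (by positivity))).mul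
        ((hfT z hz).comp (hpt z)).norm
    refine tendsto_nhds_unique ((hlam z hz).comp (hpt z)) (h1.congr' ?_)
    filter_upwards [hfin] with n hn
    exact ((T n).lam_eq z hz _ (coe_sphFin hn).symm).symm
  · intro K hKU hK ε hε
    refine hK.eventually_forall_of_prod fun z hz => ?_
    have h1 : Tendsto (fun p : ℕ × ℂ => lam p.2) (atTop ×ˢ 𝓝 z) (𝓝 (lam z)) :=
      (hcont z (hKU hz)).tendsto.comp tendsto_snd
    have h2 := (hlam z (hKU hz)).dist h1
    rw [dist_self] at h2
    exact h2.eventually_lt_const hε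

/-- Convergence dichotomy for sequences of Weierstrass `m`-triples: if `gₙ → g` locally
uniformly (spherically) with `g` nonconstant meromorphic, and the curvatures are uniformly
bounded, then a subsequence of the curvatures tends to `0` locally uniformly, or a
subsequence of the metrics converges locally uniformly to the metric of a Weierstrass
`m`-triple with function `g`. -/
theorem weierstrass_convergence_dichotomy (m : ℕ) (hm : 0 < m) (U : Set ℂ)
    (T : ℕ → WeierstrassTriple m U) (g : ℂ → OnePoint ℂ)
    (hg : SphHolomorphicOn g U)
    (hnc : ∃ z ∈ U, ∃ w ∈ U, g z ≠ g w)
    (hconv : SphLocUnifOn (fun n => (T n).g) g U)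
    (hbdd : ∃ B : ℝ, ∀ n, ∀ z ∈ U, |(T n).curv z| ≤ B) :
    (∃ φ : ℕ → ℕ, StrictMono φ ∧
        RealLocUnifOn (fun k => (T (φ k)).curv) (fun _ => 0) U) ∨
      (∃ φ : ℕ → ℕ, StrictMono φ ∧ ∃ S : WeierstrassTriple m U,
        (∀ z ∈ U, S.g z = g z) ∧
        RealLocUnifOn (fun k => (T (φ k)).lam) S.lam U) := by
  obtain ⟨B, hB⟩ := hbdd
  obtain ⟨p, hp⟩ := (T 0).isConnected.nonempty
  by_cases hlim : Tendsto (fun n => (T n).lam p) atTop atTop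
  · exact Or.inl ⟨id, strictMono_id, realLocUnifOn_curv_of_tendsto_atTop hm hB
      (fun z hz => nonempty_localChart T hg hnc hconv hz) hp hlim⟩
  · right
    rw [tendsto_atTop] at hlim
    push Not at hlim
    obtain ⟨A, hA⟩ := hlim
    obtain ⟨φ, hφ, hφA⟩ := extraction_of_frequently_atTop hA
    have hconvφ := hconv.comp_strictMono hφ
    obtain ⟨ψ, hψ, f, hf, hfT⟩ := exists_subseq_f_tendsto (T := fun n => T (φ n)) hm
      (fun n => hB (φ n)) (fun z hz => nonempty_localChart _ hg hnc hconvφ hz) hp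
      fun n => (hφA n).le
    exact ⟨φ ∘ ψ, hφ.comp hψ, exists_limit_weierstrassTriple (T := fun n => T (φ (ψ n))) hm hg hnc
      (hconvφ.comp_strictMono hψ) (fun n => hB (φ (ψ n))) hf hfT⟩

end
end

section
/- (Bernstein-type theorem via Weierstrass data) Let (Σ, f dz, g) be a Weierstrass 2-triple — the Enneper–Weierstrass data of a minimal surface in ℝ³, where g is the stereographically projected Gauss map and ds² = (1+|g|²)² |f|² |dz|² is the induced metric. If ds² is complete on Σ and the image of g is not dense in the Riemann sphere Ĉ (equivalently, the image of the Gauss map is not dense in S²), then g is constant, i.e., the minimal surface is a plane. -/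
open Filter Set MeasureTheory Topology
open scoped ENNReal

noncomputable section

/-- `φ` maps `V` into `U` and solves the holomorphic ODE `φ' = 1 / F(φ)` there. -/
def IsReciprocalFlow (F : ℂ → ℂ) (U : Set ℂ) (φ : ℂ → ℂ) (V : Set ℂ) : Prop :=
  ∀ z ∈ V, φ z ∈ U ∧ HasDerivAt φ (F (φ z))⁻¹ z

theorem IsReciprocalFlow.mono {F φ : ℂ → ℂ} {U V W : Set ℂ} (h : IsReciprocalFlow F U φ V)
    (hW : W ⊆ V) : IsReciprocalFlow F U φ W :=
  fun z hz => h z (hW hz)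

theorem IsReciprocalFlow.continuousOn {F φ : ℂ → ℂ} {U V : Set ℂ}
    (h : IsReciprocalFlow F U φ V) : ContinuousOn φ V :=
  fun z hz => (h z hz).2.continuousAt.continuousWithinAt

theorem IsReciprocalFlow.differentiableOn {F φ : ℂ → ℂ} {U V : Set ℂ}
    (h : IsReciprocalFlow F U φ V) : DifferentiableOn ℂ φ V :=
  fun z hz => (h z hz).2.differentiableAt.differentiableWithinAt

theorem IsReciprocalFlow.comp_sub_const {F φ : ℂ → ℂ} {U : Set ℂ} {r : ℝ}
    (h : IsReciprocalFlow F U φ (Metric.ball 0 r)) (c : ℂ) :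
    IsReciprocalFlow F U (fun z => φ (z - c)) (Metric.ball c r) := by
  intro z hz
  have hz' : z - c ∈ Metric.ball (0 : ℂ) r := by
    simpa [dist_eq_norm] using hz
  exact ⟨(h _ hz').1, (h _ hz').2.comp_sub_const z c⟩

/-- A nowhere vanishing holomorphic function is locally the derivative of a chart. -/
theorem exists_chart_hasDerivAt {F : ℂ → ℂ} {U : Set ℂ} (hU : IsOpen U)
    (hF : DifferentiableOn ℂ F U) (hF0 : ∀ z ∈ U, F z ≠ 0) {q : ℂ} (hq : q ∈ U) :
    ∃ e : OpenPartialHomeomorph ℂ ℂ, q ∈ e.source ∧ e.source ⊆ U ∧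
      ∀ x ∈ e.source, HasDerivAt e (F x) x := by
  obtain ⟨s, hs, hsU⟩ := Metric.isOpen_iff.1 hU q hq
  obtain ⟨G, hG⟩ := (hF.mono hsU).isExactOn_ball
  have hGd : DifferentiableOn ℂ G (Metric.ball q s) :=
    fun z hz => (hG z hz).differentiableAt.differentiableWithinAt
  have hqs : q ∈ Metric.ball q s := Metric.mem_ball_self hs
  have hstrict : HasStrictDerivAt G (F q) q := by
    have h1 := (hGd.analyticAt (Metric.isOpen_ball.mem_nhds hqs)).hasStrictDerivAt
    rwa [(hG q hqs).deriv] at h1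
  have hstrict' := hstrict.hasStrictFDerivAt_equiv (hF0 q hq)
  let e := hstrict'.toOpenPartialHomeomorph G
  have hqe : q ∈ e.source := hstrict'.mem_toOpenPartialHomeomorph_source
  have hcoe : (e : ℂ → ℂ) = G := hstrict'.toOpenPartialHomeomorph_coe
  refine ⟨e.restrOpen (Metric.ball q s) Metric.isOpen_ball, ?_, ?_, ?_⟩
  · simpa using ⟨hqe, hs⟩
  · rintro x hx
    rw [OpenPartialHomeomorph.restrOpen_source] at hx
    exact hsU hx.2
  · rintro x hx
    rw [OpenPartialHomeomorph.restrOpen_source] at hx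
    simpa [hcoe] using hG x hx.2

theorem IsReciprocalFlow.eqOn {F φ ψ : ℂ → ℂ} {U V : Set ℂ} (hU : IsOpen U)
    (hF : DifferentiableOn ℂ F U) (hF0 : ∀ z ∈ U, F z ≠ 0) (hV : IsOpen V)
    (hVc : IsPreconnected V) (hφ : IsReciprocalFlow F U φ V) (hψ : IsReciprocalFlow F U ψ V)
    {z₀ : ℂ} (hz₀ : z₀ ∈ V) (h : φ z₀ = ψ z₀) : EqOn φ ψ V := by
  refine (hφ.differentiableOn.analyticOnNhd hV).eqOn_of_preconnected_of_eventuallyEq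
    (hψ.differentiableOn.analyticOnNhd hV) hVc hz₀ ?_
  obtain ⟨e, hqe, -, he⟩ := exists_chart_hasDerivAt hU hF hF0 (hφ z₀ hz₀).1
  have h1 : ∀ᶠ z in 𝓝 z₀, z ∈ V ∧ φ z ∈ e.source ∧ ψ z ∈ e.source := by
    refine Filter.Eventually.and (hV.mem_nhds hz₀) (Filter.Eventually.and ?_ ?_)
    · exact (hφ z₀ hz₀).2.continuousAt.eventually (e.open_source.mem_nhds hqe)
    · exact (hψ z₀ hz₀).2.continuousAt.eventually (e.open_source.mem_nhds (h ▸ hqe))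
  obtain ⟨r, hr, hball⟩ := Metric.eventually_nhds_iff_ball.1 h1
  have hd : ∀ χ : ℂ → ℂ, IsReciprocalFlow F U χ V → ∀ z ∈ V, χ z ∈ e.source →
      HasDerivAt (e ∘ χ) 1 z := by
    intro χ hχ z hz hze
    have := (he _ hze).comp z (hχ z hz).2
    rwa [mul_inv_cancel₀ (hF0 _ (hχ z hz).1)] at this
  have hdφ : ∀ z ∈ Metric.ball z₀ r, HasDerivAt (e ∘ φ) 1 z :=
    fun z hz => hd φ hφ z (hball z hz).1 (hball z hz).2.1
  have hdψ : ∀ z ∈ Metric.ball z₀ r, HasDerivAt (e ∘ ψ) 1 z :=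
    fun z hz => hd ψ hψ z (hball z hz).1 (hball z hz).2.2
  have heq : EqOn (e ∘ φ) (e ∘ ψ) (Metric.ball z₀ r) := by
    refine Metric.isOpen_ball.eqOn_of_deriv_eq (𝕜 := ℂ) (convex_ball z₀ r).isPreconnected
      (fun z hz => (hdφ z hz).differentiableAt.differentiableWithinAt)
      (fun z hz => (hdψ z hz).differentiableAt.differentiableWithinAt)
      (fun z hz => ?_) (Metric.mem_ball_self hr) (by simp [h])
    rw [(hdφ z hz).deriv, (hdψ z hz).deriv]
  filter_upwards [Metric.ball_mem_nhds z₀ hr] with z hz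
  exact e.injOn (hball z hz).2.1 (hball z hz).2.2 (heq hz)

/-- Local solutions exist on discs whose radius is locally bounded below. -/
theorem exists_isReciprocalFlow_near {F : ℂ → ℂ} {U : Set ℂ} (hU : IsOpen U)
    (hF : DifferentiableOn ℂ F U) (hF0 : ∀ z ∈ U, F z ≠ 0) {q : ℂ} (hq : q ∈ U) :
    ∃ ε > 0, ∀ᶠ p in 𝓝 q, ∃ φ, IsReciprocalFlow F U φ (Metric.ball 0 ε) ∧ φ 0 = p := by
  obtain ⟨e, hqe, heU, he⟩ := exists_chart_hasDerivAt hU hF hF0 hq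
  obtain ⟨s, hs, hst⟩ := Metric.isOpen_iff.1 e.open_target _ (e.map_source hqe)
  refine ⟨s / 2, by positivity, ?_⟩
  have hc : ∀ᶠ p in 𝓝 q, e p ∈ Metric.ball (e q) (s / 2) :=
    (he q hqe).continuousAt.eventually (Metric.ball_mem_nhds _ (by positivity))
  filter_upwards [hc, e.open_source.mem_nhds hqe] with p hp hpe
  refine ⟨fun w => e.symm (w + e p), fun w hw => ?_, by simp [e.left_inv hpe]⟩
  have ht : w + e p ∈ e.target := by
    apply hst
    rw [Metric.mem_ball, dist_eq_norm] at hp hw ⊢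
    calc ‖w + e p - e q‖ = ‖(w - 0) + (e p - e q)‖ := by ring_nf
      _ ≤ _ := norm_add_le _ _
      _ < s := by linarith
  have hsrc := e.map_target ht
  refine ⟨heU hsrc, ?_⟩
  exact (e.hasDerivAt_symm ht (hF0 _ (heU hsrc)) (he _ hsrc)).comp_add_const w (e p)

theorem exists_isReciprocalFlow_of_isCompact {F : ℂ → ℂ} {U K : Set ℂ} (hU : IsOpen U)
    (hF : DifferentiableOn ℂ F U) (hF0 : ∀ z ∈ U, F z ≠ 0) (hK : IsCompact K) (hKU : K ⊆ U) :
    ∃ ε > 0, ∀ p ∈ K, ∃ φ, IsReciprocalFlow F U φ (Metric.ball 0 ε) ∧ φ 0 = p := by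
  refine hK.induction_on (p := fun S => ∃ ε > 0, ∀ p ∈ S, ∃ φ,
    IsReciprocalFlow F U φ (Metric.ball 0 ε) ∧ φ 0 = p) ⟨1, one_pos, by simp⟩ ?_ ?_ ?_
  · rintro S T hST ⟨ε, hε, h⟩
    exact ⟨ε, hε, fun p hp => h p (hST hp)⟩
  · rintro S T ⟨ε, hε, h⟩ ⟨ε', hε', h'⟩
    refine ⟨min ε ε', lt_min hε hε', ?_⟩
    rintro p (hp | hp)
    · obtain ⟨φ, hφ, h0⟩ := h p hp
      exact ⟨φ, hφ.mono (Metric.ball_subset_ball (min_le_left _ _)), h0⟩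
    · obtain ⟨φ, hφ, h0⟩ := h' p hp
      exact ⟨φ, hφ.mono (Metric.ball_subset_ball (min_le_right _ _)), h0⟩
  · intro q hq
    obtain ⟨ε, hε, h⟩ := exists_isReciprocalFlow_near hU hF hF0 (hKU hq)
    exact ⟨_, mem_nhdsWithin_of_mem_nhds h, ε, hε, fun p hp => hp⟩

theorem IsReciprocalFlow.glue {ι : Type*} {F : ℂ → ℂ} {U : Set ℂ} {V : ι → Set ℂ}
    {ψ : ι → ℂ → ℂ} (hV : ∀ i, IsOpen (V i)) (hψ : ∀ i, IsReciprocalFlow F U (ψ i) (V i))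
    (hag : ∀ i j, EqOn (ψ i) (ψ j) (V i ∩ V j)) :
    ∃ φ, IsReciprocalFlow F U φ (⋃ i, V i) ∧ ∀ i, EqOn φ (ψ i) (V i) := by
  classical
  let φ : ℂ → ℂ := fun z => if h : ∃ i, z ∈ V i then ψ h.choose z else 0
  have hφ : ∀ i, EqOn φ (ψ i) (V i) := by
    intro i z hz
    have h : ∃ i, z ∈ V i := ⟨i, hz⟩
    simp only [φ, dif_pos h]
    exact hag _ _ ⟨h.choose_spec, hz⟩
  refine ⟨φ, fun z hz => ?_, hφ⟩
  obtain ⟨i, hi⟩ := mem_iUnion.1 hz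
  rw [hφ i hi]
  exact ⟨(hψ i z hi).1, (hψ i z hi).2.congr_of_eventuallyEq
    ((hφ i).eventuallyEq_of_mem ((hV i).mem_nhds hi))⟩

/-- Solutions on concentric discs of bounded radii glue to a solution on the limiting disc. -/
theorem exists_isReciprocalFlow_sSup {F : ℂ → ℂ} {U : Set ℂ} (hU : IsOpen U)
    (hF : DifferentiableOn ℂ F U) (hF0 : ∀ z ∈ U, F z ≠ 0) {p : ℂ} {S : Set ℝ} (hS : S.Nonempty)
    (hpos : ∀ r ∈ S, 0 < r)
    (hex : ∀ r ∈ S, ∃ φ, IsReciprocalFlow F U φ (Metric.ball 0 r) ∧ φ 0 = p) :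
    ∃ φ, IsReciprocalFlow F U φ (Metric.ball 0 (sSup S)) ∧ φ 0 = p := by
  choose! ψ hψ hψ0 using hex
  obtain ⟨φ, hφ, hφeq⟩ := IsReciprocalFlow.glue (F := F) (U := U)
    (V := fun r : S => Metric.ball 0 (r : ℝ)) (ψ := fun r : S => ψ r)
    (fun _ => Metric.isOpen_ball) (fun r => hψ r r.2) (by
      intro r s
      refine IsReciprocalFlow.eqOn hU hF hF0 (Metric.isOpen_ball.inter Metric.isOpen_ball)
        ((convex_ball _ _).inter (convex_ball _ _)).isPreconnected
        ((hψ r r.2).mono inter_subset_left) ((hψ s s.2).mono inter_subset_right)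
        (z₀ := 0) ⟨Metric.mem_ball_self (hpos r r.2), Metric.mem_ball_self (hpos s s.2)⟩ ?_
      rw [hψ0 r r.2, hψ0 s s.2])
  refine ⟨φ, hφ.mono fun z hz => ?_, ?_⟩
  · rw [mem_ball_zero_iff] at hz
    obtain ⟨r, hr, hzr⟩ := exists_lt_of_lt_csSup hS hz
    exact mem_iUnion.2 ⟨⟨r, hr⟩, by simpa using hzr⟩
  · obtain ⟨r, hr⟩ := hS
    rw [hφeq ⟨r, hr⟩ (Metric.mem_ball_self (hpos r hr)), hψ0 r hr]

/-- A solution on a disc that continues past every boundary point continues to a larger disc. -/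
theorem exists_isReciprocalFlow_larger_ball {F φ : ℂ → ℂ} {U : Set ℂ} (hU : IsOpen U)
    (hF : DifferentiableOn ℂ F U) (hF0 : ∀ z ∈ U, F z ≠ 0) {R : ℝ} (hR : 0 < R)
    (hbd : ∀ b ∈ Metric.closedBall (0 : ℂ) R, ∃ ε > 0, ∃ ψ,
      IsReciprocalFlow F U ψ (Metric.ball b ε) ∧
        EqOn ψ φ (Metric.ball b ε ∩ Metric.ball 0 R)) :
    ∃ R' > R, ∃ ψ, IsReciprocalFlow F U ψ (Metric.ball 0 R') ∧ ψ 0 = φ 0 := by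
  choose! ε hε ψ hψ hag using hbd
  obtain ⟨δ, hδ, hleb⟩ := lebesgue_number_lemma_of_metric
    (c := fun b : Metric.closedBall (0 : ℂ) R => Metric.ball (b : ℂ) (ε b))
    (isCompact_closedBall (0 : ℂ) R) (fun _ => Metric.isOpen_ball)
    (fun b hb => mem_iUnion.2 ⟨⟨b, hb⟩, Metric.mem_ball_self (hε b hb)⟩)
  have hne : Nonempty (Metric.closedBall (0 : ℂ) R) := ⟨⟨0, Metric.mem_closedBall_self hR.le⟩⟩
  choose! c hc using hleb
  have hflow : ∀ b ∈ Metric.closedBall (0 : ℂ) R,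
      IsReciprocalFlow F U (ψ (c b)) (Metric.ball b δ) :=
    fun b hb => (hψ _ (c b).2).mono (hc b hb)
  have hagree : ∀ b ∈ Metric.closedBall (0 : ℂ) R,
      EqOn (ψ (c b)) φ (Metric.ball b δ ∩ Metric.ball 0 R) :=
    fun b hb => (hag _ (c b).2).mono (inter_subset_inter_left _ (hc b hb))
  obtain ⟨χ, hχ, hχeq⟩ := IsReciprocalFlow.glue (F := F) (U := U)
    (V := fun b : Metric.closedBall (0 : ℂ) R => Metric.ball (b : ℂ) δ)
    (ψ := fun b => ψ (c b)) (fun _ => Metric.isOpen_ball) (fun b => hflow b b.2) (by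
      intro b b'
      rintro z ⟨hz, hz'⟩
      have hbb : dist (b : ℂ) b' < δ + δ := by
        have h3 := dist_triangle_left (b : ℂ) b' z
        rw [Metric.mem_ball] at hz hz'
        linarith
      have hm : midpoint ℝ (b : ℂ) b' ∈ Metric.ball (b : ℂ) δ ∩ Metric.ball (b' : ℂ) δ := by
        constructor
        · rw [Metric.mem_ball, dist_midpoint_left]
          norm_num
          linarith
        · rw [Metric.mem_ball, dist_midpoint_right]
          norm_num
          linarith
      have hmR : midpoint ℝ (b : ℂ) b' ∈ closure (Metric.ball (0 : ℂ) R) := by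
        rw [closure_ball _ hR.ne']
        exact (convex_closedBall (0 : ℂ) R).midpoint_mem b.2 b'.2
      obtain ⟨y, hy, hyR⟩ := mem_closure_iff.1 hmR _
        (Metric.isOpen_ball.inter Metric.isOpen_ball) hm
      refine IsReciprocalFlow.eqOn hU hF hF0 (Metric.isOpen_ball.inter Metric.isOpen_ball)
        ((convex_ball _ _).inter (convex_ball _ _)).isPreconnected
        ((hflow b b.2).mono inter_subset_left) ((hflow b' b'.2).mono inter_subset_right)
        (z₀ := y) hy ?_ ⟨hz, hz'⟩
      rw [hagree b b.2 ⟨hy.1, hyR⟩, hagree b' b'.2 ⟨hy.2, hyR⟩])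
  have h0 : (0 : ℂ) ∈ Metric.closedBall (0 : ℂ) R := Metric.mem_closedBall_self hR.le
  refine ⟨R + δ, by linarith, χ, hχ.mono fun z hz => ?_, ?_⟩
  · rw [mem_ball_zero_iff] at hz
    rcases le_or_gt ‖z‖ R with hzR | hzR
    · exact mem_iUnion.2 ⟨⟨z, by simpa using hzR⟩, Metric.mem_ball_self hδ⟩
    · have hz0 : 0 < ‖z‖ := hR.trans hzR
      refine mem_iUnion.2 ⟨⟨((R / ‖z‖ : ℝ) : ℂ) * z, ?_⟩, ?_⟩
      · rw [mem_closedBall_zero_iff, norm_mul, Complex.norm_real, Real.norm_of_nonneg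
          (by positivity), div_mul_cancel₀ _ hz0.ne']
      · have h1 : z - ((R / ‖z‖ : ℝ) : ℂ) * z = ((1 - R / ‖z‖ : ℝ) : ℂ) * z := by
          push_cast
          ring
        have h2 : 0 ≤ 1 - R / ‖z‖ := by
          rw [sub_nonneg, div_le_one hz0]
          exact hzR.le
        rw [Metric.mem_ball, dist_eq_norm, h1, norm_mul, Complex.norm_real,
          Real.norm_of_nonneg h2, sub_mul, div_mul_cancel₀ _ hz0.ne']
        linarith
  · rw [hχeq ⟨0, h0⟩ (Metric.mem_ball_self hδ)]
    exact hagree 0 h0 ⟨Metric.mem_ball_self hδ, Metric.mem_ball_self hR⟩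

/-- Under a complete metric dominated by `‖F‖`, the image of a ray keeps returning to some
compact set. -/
theorem IsReciprocalFlow.exists_compact_frequently {F φ : ℂ → ℂ} {U : Set ℂ} {lam : ℂ → ℝ}
    {C : ℝ} (hF0 : ∀ z ∈ U, F z ≠ 0)
    (hlam : ∀ z ∈ U, lam z ≤ C * ‖F z‖) (hcomp : IsCompleteMetric lam U) {R : ℝ} (hR : 0 < R)
    (hφ : IsReciprocalFlow F U φ (Metric.ball 0 R)) {b : ℂ} (hb : ‖b‖ ≤ R) :
    ∃ K, IsCompact K ∧ K ⊆ U ∧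
      ∀ t₀ ∈ Ico (0 : ℝ) 1, ∃ t, t₀ ≤ t ∧ t < 1 ∧ φ (t * b) ∈ K := by
  by_contra hcon
  push Not at hcon
  have hmem : ∀ t ∈ Ico (0 : ℝ) 1, (t : ℂ) * b ∈ Metric.ball (0 : ℂ) R := by
    rintro t ⟨ht0, ht1⟩
    rw [mem_ball_zero_iff, norm_mul, Complex.norm_real, Real.norm_of_nonneg ht0]
    nlinarith [norm_nonneg b]
  have hder : ∀ t ∈ Ico (0 : ℝ) 1,
      HasDerivAt (fun t : ℝ => φ (t * b)) ((F (φ (t * b)))⁻¹ * b) t := by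
    intro t ht
    have h1 : HasDerivAt (fun t : ℝ => (t : ℂ) * b) b t := by
      simpa using (Complex.ofRealCLM.hasDerivAt (x := t)).mul_const b
    exact (hφ _ (hmem t ht)).2.comp t h1
  let γ : DivergentPath U (φ 0) :=
    { toFun := fun t => φ (t * b)
      start := by simp
      mem := fun t ht => (hφ _ (hmem t ht)).1
      cont := fun t ht => (hder t ht).continuousAt.continuousWithinAt
      diff := fun t ht => (hder t (Ioo_subset_Ico_self ht)).differentiableAt
      divergent := fun K hK hKU => hcon K hK hKU }
  have htop := hcomp (φ 0) (hφ 0 (Metric.mem_ball_self hR)).1 γ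
  refine absurd htop (ne_of_lt ?_)
  have hle : pathLen lam γ.toFun ≤ ∫⁻ _ in Ioo (0 : ℝ) 1, ENNReal.ofReal (C * ‖b‖) := by
    refine setLIntegral_mono' measurableSet_Ioo fun t ht => ENNReal.ofReal_le_ofReal ?_
    have ht' := Ioo_subset_Ico_self ht
    have hU' := (hφ _ (hmem t ht')).1
    have hFpos : 0 < ‖F (φ (t * b))‖ := norm_pos_iff.2 (hF0 _ hU')
    change lam (φ (t * b)) * ‖deriv (fun t : ℝ => φ (t * b)) t‖ ≤ C * ‖b‖
    rw [(hder t ht').deriv, norm_mul, norm_inv]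
    calc lam (φ (t * b)) * (‖F (φ (t * b))‖⁻¹ * ‖b‖)
        ≤ (C * ‖F (φ (t * b))‖) * (‖F (φ (t * b))‖⁻¹ * ‖b‖) := by
          gcongr
          exact hlam _ hU'
      _ = C * ‖b‖ := by field_simp
  refine hle.trans_lt ?_
  simp

/-- If a complete metric on `U` is dominated by the flat metric `‖F‖ |dz|`, then solutions of
`φ' = 1 / F(φ)` exist on arbitrarily large discs. -/
theorem exists_isReciprocalFlow_of_isCompleteMetric {F : ℂ → ℂ} {U : Set ℂ} {lam : ℂ → ℝ}
    {C : ℝ} (hU : IsOpen U) (hF : DifferentiableOn ℂ F U) (hF0 : ∀ z ∈ U, F z ≠ 0)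
    (hlam : ∀ z ∈ U, lam z ≤ C * ‖F z‖) (hcomp : IsCompleteMetric lam U) {p : ℂ} (hp : p ∈ U)
    (r : ℝ) : ∃ φ, IsReciprocalFlow F U φ (Metric.ball 0 r) ∧ φ 0 = p := by
  by_contra hr
  let S : Set ℝ := {s | 0 < s ∧ ∃ φ, IsReciprocalFlow F U φ (Metric.ball 0 s) ∧ φ 0 = p}
  have hSne : S.Nonempty := by
    obtain ⟨ε, hε, h⟩ := exists_isReciprocalFlow_near hU hF hF0 hp
    exact ⟨ε, hε, h.self_of_nhds⟩
  have hSbdd : BddAbove S := by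
    refine ⟨r, fun s hs => ?_⟩
    by_contra! hrs
    obtain ⟨φ, hφ, h0⟩ := hs.2
    exact hr ⟨φ, hφ.mono (Metric.ball_subset_ball hrs.le), h0⟩
  obtain ⟨φ, hφ, hφ0⟩ := exists_isReciprocalFlow_sSup hU hF hF0 hSne
    (fun s hs => hs.1) (fun s hs => hs.2)
  have hR : 0 < sSup S := by
    obtain ⟨s, hs⟩ := hSne
    exact hs.1.trans_le (le_csSup hSbdd hs)
  obtain ⟨R', hR', ψ, hψ, hψ0⟩ := exists_isReciprocalFlow_larger_ball (φ := φ) hU hF hF0 hR (by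
    intro b hb
    rw [mem_closedBall_zero_iff] at hb
    obtain ⟨K, hK, hKU, hret⟩ := hφ.exists_compact_frequently hF0 hlam hcomp hR hb
    obtain ⟨ε, hε, hloc⟩ := exists_isReciprocalFlow_of_isCompact hU hF hF0 hK hKU
    obtain ⟨t, ht0, ht1, htK⟩ := hret (max 0 (1 - ε / (2 * sSup S)))
      ⟨le_max_left _ _, max_lt one_pos (by linarith [show 0 < ε / (2 * sSup S) by positivity])⟩
    have ht0' : 0 ≤ t := (le_max_left _ _).trans ht0
    have ht1' : 1 - ε / (2 * sSup S) ≤ t := (le_max_right _ _).trans ht0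
    have htb : ‖b - t * b‖ ≤ ε / 2 := by
      have h1 : b - t * b = ((1 - t : ℝ) : ℂ) * b := by
        push_cast
        ring
      rw [h1, norm_mul, Complex.norm_real, Real.norm_of_nonneg (by linarith)]
      calc (1 - t) * ‖b‖ ≤ (ε / (2 * sSup S)) * sSup S := by
            gcongr
            linarith
        _ = ε / 2 := by field_simp
    have htR : (t : ℂ) * b ∈ Metric.ball (0 : ℂ) (sSup S) := by
      rw [mem_ball_zero_iff, norm_mul, Complex.norm_real, Real.norm_of_nonneg ht0']
      nlinarith [norm_nonneg b]
    obtain ⟨ψ, hψ, hψ0⟩ := hloc _ htK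
    have hψ' := hψ.comp_sub_const ((t : ℂ) * b)
    have hsub : Metric.ball b (ε / 2) ⊆ Metric.ball ((t : ℂ) * b) ε := by
      refine Metric.ball_subset_ball' ?_
      rw [dist_eq_norm]
      linarith
    refine ⟨ε / 2, by positivity, _, hψ'.mono hsub, ?_⟩
    refine EqOn.mono (inter_subset_inter_left _ hsub) ?_
    refine IsReciprocalFlow.eqOn hU hF hF0 (Metric.isOpen_ball.inter Metric.isOpen_ball)
      ((convex_ball _ _).inter (convex_ball _ _)).isPreconnected
      (hψ'.mono inter_subset_left) (hφ.mono inter_subset_right)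
      (z₀ := (t : ℂ) * b) ⟨Metric.mem_ball_self hε, htR⟩ ?_
    simpa using hψ0)
  exact absurd (le_csSup hSbdd ⟨hR.trans hR', ψ, hψ, hψ0.trans hφ0⟩) hR'.not_ge

/-- **Liouville's theorem** for a domain with a complete metric dominated by a flat one. -/
theorem deriv_eq_zero_of_isCompleteMetric {F h : ℂ → ℂ} {U : Set ℂ} {lam : ℂ → ℝ} {C M : ℝ}
    (hU : IsOpen U) (hF : DifferentiableOn ℂ F U) (hF0 : ∀ z ∈ U, F z ≠ 0)
    (hlam : ∀ z ∈ U, lam z ≤ C * ‖F z‖) (hcomp : IsCompleteMetric lam U)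
    (hh : DifferentiableOn ℂ h U) (hM : ∀ z ∈ U, ‖h z‖ ≤ M) {p : ℂ} (hp : p ∈ U) :
    deriv h p = 0 := by
  have hbound : ∀ r > 0, ‖deriv h p * (F p)⁻¹‖ ≤ M / r := by
    intro r hr
    obtain ⟨φ, hφ, rfl⟩ :=
      exists_isReciprocalFlow_of_isCompleteMetric hU hF hF0 hlam hcomp hp (r + 1)
    have hsub : Metric.closedBall (0 : ℂ) r ⊆ Metric.ball 0 (r + 1) :=
      Metric.closedBall_subset_ball (by linarith)
    have hd : DifferentiableOn ℂ (h ∘ φ) (Metric.ball 0 (r + 1)) :=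
      hh.comp hφ.differentiableOn fun z hz => (hφ z hz).1
    have h0 : (0 : ℂ) ∈ Metric.ball (0 : ℂ) (r + 1) := Metric.mem_ball_self (by linarith)
    have hder := ((hh.differentiableAt (hU.mem_nhds hp)).hasDerivAt.comp (0 : ℂ) (hφ 0 h0).2)
    rw [← hder.deriv]
    refine Complex.norm_deriv_le_of_forall_mem_sphere_norm_le hr ?_ fun z hz =>
      hM _ (hφ z (hsub (Metric.sphere_subset_closedBall hz))).1
    exact (hd.mono (closure_ball (0 : ℂ) hr.ne' ▸ hsub)).diffContOnCl
  have hlim : Tendsto (fun r : ℝ => M / r) atTop (𝓝 0) := tendsto_const_nhds.div_atTop tendsto_id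
  have hle : ‖deriv h p * (F p)⁻¹‖ ≤ 0 :=
    ge_of_tendsto hlim ((eventually_gt_atTop 0).mono hbound)
  exact (mul_eq_zero.1 (norm_le_zero_iff.1 hle)).resolve_right (inv_ne_zero (hF0 p hp))

/-- The Möbius transformation `w ↦ 1 / (w - a)`, with values in `ℂ` away from `a`. -/
def invSub (a : ℂ) : OnePoint ℂ → ℂ
  | OnePoint.infty => 0
  | (w : ℂ) => (w - a)⁻¹

@[simp]
theorem invSub_infty (a : ℂ) : invSub a OnePoint.infty = 0 := rfl

@[simp]
theorem invSub_coe (a w : ℂ) : invSub a (w : OnePoint ℂ) = (w - a)⁻¹ := rfl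

theorem invSub_injOn {a : ℂ} {x y : OnePoint ℂ} (hx : x ≠ (a : OnePoint ℂ))
    (hy : y ≠ (a : OnePoint ℂ)) (h : invSub a x = invSub a y) : x = y := by
  induction x using OnePoint.rec with
  | infty =>
    induction y using OnePoint.rec with
    | infty => rfl
    | coe w =>
      rw [invSub_infty, invSub_coe, eq_comm, inv_eq_zero, sub_eq_zero] at h
      exact absurd (by rw [h]) hy
  | coe v =>
    induction y using OnePoint.rec with
    | infty =>
      rw [invSub_infty, invSub_coe, inv_eq_zero, sub_eq_zero] at h
      exact absurd (by rw [h]) hx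
    | coe w =>
      rw [invSub_coe, invSub_coe, inv_inj, sub_left_inj] at h
      rw [h]

theorem norm_invSub_le {a : ℂ} {r : ℝ} (hr : 0 < r) {x : OnePoint ℂ}
    (hx : ∀ w : ℂ, x = (w : OnePoint ℂ) → r ≤ ‖w - a‖) : ‖invSub a x‖ ≤ r⁻¹ := by
  induction x using OnePoint.rec with
  | infty => simpa using hr.le
  | coe w =>
    rw [invSub_coe, norm_inv]
    gcongr
    exact hx w rfl

theorem SphHolomorphicOn.differentiableOn_invSub {g : ℂ → OnePoint ℂ} {U : Set ℂ}
    (hg : SphHolomorphicOn g U) (hU : IsOpen U) {a : ℂ}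
    (ha : ∀ z ∈ U, g z ≠ (a : OnePoint ℂ)) :
    DifferentiableOn ℂ (fun z => invSub a (g z)) U := by
  intro z hz
  obtain ⟨V, hV, hzV, h, hh, hgh⟩ := hg z hz
  have hUV : U ∩ V ∈ 𝓝 z := (hU.inter hV).mem_nhds ⟨hz, hzV⟩
  have hhz : DifferentiableAt ℂ h z := hh.differentiableAt (hV.mem_nhds hzV)
  refine DifferentiableAt.differentiableWithinAt ?_
  rcases hgh with hgh | hgh
  · have hne : h z - a ≠ 0 := fun h0 => ha z hz (by rw [hgh z hzV, sub_eq_zero.1 h0])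
    refine ((hhz.sub_const a).inv hne).congr_of_eventuallyEq ?_
    filter_upwards [hUV] with w hw
    rw [hgh w hw.2, invSub_coe]
    rfl
  · have hne : ∀ w ∈ U ∩ V, 1 - a * h w ≠ 0 := by
      intro w hw h0
      have h1 : a * h w = 1 := (sub_eq_zero.1 h0).symm
      have hw0 : h w ≠ 0 := right_ne_zero_of_mul_eq_one h1
      refine ha w hw.1 ?_
      rw [hgh w hw.2, if_neg hw0, eq_inv_of_mul_eq_one_left h1]
    refine (hhz.div ((hhz.const_mul a).const_sub 1) (hne z ⟨hz, hzV⟩)).congr_of_eventuallyEq ?_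
    filter_upwards [hUV] with w hw
    have hnew := hne w hw
    rw [hgh w hw.2]
    split_ifs with h0
    · simp [h0]
    · rw [invSub_coe]
      have h2 : (h w)⁻¹ - a = (1 - a * h w) / h w := by field_simp
      rw [h2, inv_div]
      rfl

theorem exists_ball_avoiding {g : ℂ → OnePoint ℂ} {U : Set ℂ} (h : ¬ Dense (g '' U)) :
    ∃ (a : ℂ) (r : ℝ), 0 < r ∧
      ∀ z ∈ U, ∀ w : ℂ, g z = (w : OnePoint ℂ) → r ≤ ‖w - a‖ := by
  rw [dense_iff_inter_open] at h
  push Not at h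
  obtain ⟨O, hO, hOne, hemp⟩ := h
  obtain ⟨a, ha⟩ := (OnePoint.denseRange_coe (X := ℂ)).exists_mem_open hO hOne
  obtain ⟨r, hr, hball⟩ := Metric.isOpen_iff.1 (hO.preimage OnePoint.continuous_coe) a ha
  refine ⟨a, r, hr, fun z hz w hw => ?_⟩
  by_contra! hlt
  have hwO : (w : OnePoint ℂ) ∈ O := hball (by rwa [Metric.mem_ball, dist_eq_norm])
  exact eq_empty_iff_forall_notMem.1 hemp w ⟨hwO, z, hz, hw⟩

theorem one_add_norm_sq_le {E : Type*} [SeminormedAddCommGroup E] {w a : E} {r : ℝ} (hr : 0 < r)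
    (h : r ≤ ‖w - a‖) :
    1 + ‖w‖ ^ 2 ≤ ((1 + 2 * ‖a‖ ^ 2) / r ^ 2 + 2) * ‖w - a‖ ^ 2 := by
  have h1 : ‖w‖ ≤ ‖w - a‖ + ‖a‖ := by simpa using norm_add_le (w - a) a
  have h2 : 1 ≤ ‖w - a‖ ^ 2 / r ^ 2 := by
    rw [one_le_div (by positivity)]
    gcongr
  have h3 : 1 + 2 * ‖a‖ ^ 2 ≤ (1 + 2 * ‖a‖ ^ 2) * (‖w - a‖ ^ 2 / r ^ 2) :=
    le_mul_of_one_le_right (by positivity) h2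
  calc 1 + ‖w‖ ^ 2 ≤ (1 + 2 * ‖a‖ ^ 2) + 2 * ‖w - a‖ ^ 2 := by
        nlinarith [sq_nonneg (‖w - a‖ - ‖a‖), norm_nonneg w]
    _ ≤ (1 + 2 * ‖a‖ ^ 2) * (‖w - a‖ ^ 2 / r ^ 2) + 2 * ‖w - a‖ ^ 2 := by gcongr
    _ = _ := by ring

theorem norm_sub_sq_le_mul {E : Type*} [SeminormedAddCommGroup E] (w a : E) :
    ‖w - a‖ ^ 2 ≤ (2 + 2 * ‖a‖ ^ 2) * (1 + ‖w‖ ^ 2) := by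
  nlinarith [sq_nonneg (‖w‖ - ‖a‖), norm_nonneg (w - a), norm_sub_le w a,
    mul_nonneg (sq_nonneg ‖w‖) (sq_nonneg ‖a‖)]

/-- A function with isolated singularities whose norm is comparable to a continuous function
extends holomorphically across the singularities. -/
theorem exists_holomorphic_extension_of_comparable {k : ℂ → ℂ} {U : Set ℂ} {lam : ℂ → ℝ}
    {C D : ℝ} (hU : IsOpen U) (hlam : ContinuousOn lam U) (hD : 0 ≤ D)
    (hk : ∀ z₀ ∈ U, ∀ᶠ z in 𝓝[≠] z₀,
      DifferentiableAt ℂ k z ∧ lam z ≤ C * ‖k z‖ ∧ ‖k z‖ ≤ D * lam z) :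
    ∃ F : ℂ → ℂ, DifferentiableOn ℂ F U ∧ ∀ z ∈ U, lam z ≤ C * ‖F z‖ := by
  refine ⟨fun z => limUnder (𝓝[≠] z) k, ?_⟩
  suffices H : ∀ z₀ ∈ U, DifferentiableAt ℂ (fun z => limUnder (𝓝[≠] z) k) z₀ ∧
      Tendsto k (𝓝[≠] z₀) (𝓝 (limUnder (𝓝[≠] z₀) k)) by
    refine ⟨fun z hz => (H z hz).1.differentiableWithinAt, fun z hz => ?_⟩
    have h1 : Tendsto lam (𝓝[≠] z) (𝓝 (lam z)) :=
      (hlam.continuousAt (hU.mem_nhds hz)).tendsto.mono_left nhdsWithin_le_nhds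
    exact le_of_tendsto_of_tendsto h1 ((H z hz).2.norm.const_mul C)
      ((hk z hz).mono fun w hw => hw.2.1)
  intro z₀ hz₀
  have hlt : ∀ᶠ z in 𝓝 z₀, lam z < lam z₀ + 1 :=
    (hlam.continuousAt (hU.mem_nhds hz₀)).eventually_lt_const (by linarith)
  obtain ⟨s, hs, hball⟩ := Metric.eventually_nhds_iff_ball.1
    (hlt.and (eventually_nhdsWithin_iff.1 (hk z₀ hz₀)))
  have hd : ∀ z ∈ Metric.ball z₀ s \ {z₀}, DifferentiableAt ℂ k z :=
    fun z hz => ((hball z hz.1).2 hz.2).1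
  have hnhds := Metric.ball_mem_nhds z₀ hs
  have hup := Complex.differentiableOn_update_limUnder_of_bddAbove hnhds
    (fun z hz => (hd z hz).differentiableWithinAt) (by
      refine ⟨D * (lam z₀ + 1), ?_⟩
      rintro _ ⟨z, hz, rfl⟩
      refine ((hball z hz.1).2 hz.2).2.2.trans ?_
      gcongr
      exact (hball z hz.1).1.le)
  have hup' := hup.differentiableAt hnhds
  refine ⟨hup'.congr_of_eventuallyEq ?_, continuousAt_update_same.1 hup'.continuousAt⟩
  filter_upwards [hnhds] with z hz
  rcases eq_or_ne z z₀ with rfl | hne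
  · simp
  · rw [Function.update_of_ne hne]
    exact ((hd z ⟨hz, hne⟩).continuousAt.tendsto.mono_left nhdsWithin_le_nhds).limUnder_eq

/-- Bernstein-type theorem: for a complete minimal surface given by Weierstrass data
`(Σ, f dz, g)` (a Weierstrass `2`-triple with complete induced metric), if the image of
the Gauss map `g` is not dense in the Riemann sphere, then `g` is constant, i.e. the
surface is a plane. -/
theorem bernstein_gauss_map_not_dense (U : Set ℂ) (T : WeierstrassTriple 2 U)
    (hcomp : IsCompleteMetric T.lam U)
    (hnd : ¬ Dense (T.g '' U)) :
    ∀ z ∈ U, ∀ w ∈ U, T.g z = T.g w := by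
  obtain ⟨a, r, hr, hav⟩ := exists_ball_avoiding hnd
  have hU := T.isOpen
  have hne : ∀ z ∈ U, T.g z ≠ (a : OnePoint ℂ) := fun z hz h => by
    have := hav z hz a h
    rw [sub_self, norm_zero] at this
    linarith
  let h : ℂ → ℂ := fun z => invSub a (T.g z)
  have hh : DifferentiableOn ℂ h U := T.g_holo.differentiableOn_invSub hU hne
  have hM : ∀ z ∈ U, ‖h z‖ ≤ r⁻¹ := fun z hz => norm_invSub_le hr (hav z hz)
  have hiso : ∀ z₀ ∈ U, ∀ᶠ z in 𝓝[≠] z₀, h z ≠ 0 := by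
    intro z₀ hz₀
    have han := hh.analyticOnNhd hU
    refine (han z₀ hz₀).eventually_eq_zero_or_eventually_ne_zero.resolve_left fun h0 => ?_
    obtain ⟨z₁, hz₁, hg₁⟩ := T.g_mero
    obtain ⟨w, hw⟩ := OnePoint.ne_infty_iff_exists.1 hg₁
    have h1 : h z₁ = 0 :=
      han.eqOn_zero_of_preconnected_of_eventuallyEq_zero T.isConnected.isPreconnected hz₀ h0 hz₁
    simp only [h, ← hw, invSub_coe, inv_eq_zero, sub_eq_zero] at h1
    exact hne z₁ hz₁ (by rw [← hw, h1])
  obtain ⟨F, hF, hlam⟩ := exists_holomorphic_extension_of_comparable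
    (k := fun z => T.f z / h z ^ 2) (lam := T.lam)
    (C := (1 + 2 * ‖a‖ ^ 2) / r ^ 2 + 2) (D := 2 + 2 * ‖a‖ ^ 2) hU T.lam_cont (by positivity) (by
      intro z₀ hz₀
      filter_upwards [hiso z₀ hz₀, mem_nhdsWithin_of_mem_nhds (hU.mem_nhds hz₀)] with z hz hzU
      obtain ⟨w, hw⟩ : ∃ w : ℂ, (w : OnePoint ℂ) = T.g z :=
        OnePoint.ne_infty_iff_exists.1 fun hinf => hz (by simp [h, hinf])
      have hwr : r ≤ ‖w - a‖ := hav z hzU w hw.symm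
      have hfac : ‖T.f z / h z ^ 2‖ = ‖w - a‖ ^ 2 * ‖T.f z‖ := by
        simp only [h, ← hw, invSub_coe]
        rw [inv_pow, div_inv_eq_mul, norm_mul, norm_pow, mul_comm]
      have hl : T.lam z = (1 + ‖w‖ ^ 2) * ‖T.f z‖ := by
        simpa using T.lam_eq z hzU w hw.symm
      refine ⟨((T.f_holo.differentiableAt (hU.mem_nhds hzU)).div
        ((hh.differentiableAt (hU.mem_nhds hzU)).pow 2) (pow_ne_zero 2 hz)), ?_, ?_⟩
      · rw [hfac, hl, ← mul_assoc]
        gcongr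
        exact one_add_norm_sq_le hr hwr
      · rw [hfac, hl, ← mul_assoc]
        gcongr
        exact norm_sub_sq_le_mul w a)
  have hF0 : ∀ z ∈ U, F z ≠ 0 := by
    intro z hz h0
    have h1 := hlam z hz
    rw [h0, norm_zero, mul_zero] at h1
    exact absurd (T.lam_pos z hz) (not_lt.2 h1)
  intro z hz w hw
  refine invSub_injOn (a := a) (hne z hz) (hne w hw) ?_
  exact hU.is_const_of_deriv_eq_zero T.isConnected.isPreconnected hh
    (fun p hp => deriv_eq_zero_of_isCompleteMetric hU hF hF0 hlam hcomp hh hM hp) hz hw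

end
end
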